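/- Let N ⊂ M be an inclusion of von Neumann algebras with faithful normal conditional expectation E : M → N, and φ ∈ M_* a faithful normal state with φ ∘ E = φ. Assume the triple (M, N, φ) is intertwining stable. Let Θ ∈ Aut(M) be an automorphism satisfying E ∘ Θ = Θ ∘ E and Θ(φ) = uφu* for some unitary u ∈ U(N), and set Θ_N = Θ|_N. Let ψ be any strictly semifinite faithful normal weight on N. If Θ is locally pointwise inner for ψ ∘ E, then Θ_N is locally pointwise inner for ψ. -/

import Mathlib

/-!
Common framework for formalizing Houdayer–Isono,
"Pointwise inner automorphisms of almost periodic factors".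

Von Neumann algebras are modeled concretely, following Mathlib, as
`VonNeumannAlgebra H` for a complex Hilbert space `H`.  Notions that are not
available in Mathlib (normal states and weights, modular automorphism groups,
Connes cocycles, tensor/free product decompositions, …) are modeled by
explicit predicates/structures whose fields record their standard
characterizing properties (e.g. the modular group of a state is characterized
as the pointwise SOT-continuous one-parameter automorphism group satisfying
the KMS condition).
-/

open scoped ComplexOrder ENNReal

namespace HSC

variable {H : Type} [NormedAddCommGroup H] [InnerProductSpace ℂ H] [CompleteSpace H]

/-- The bounded operators on the Hilbert space `H`. -/
abbrev Op (H : Type) [NormedAddCommGroup H] [InnerProductSpace ℂ H] [CompleteSpace H] : Type :=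
  H →L[ℂ] H

/-- Positivity of a bounded operator on a Hilbert space. -/
def IsPos (x : Op H) : Prop := ContinuousLinearMap.IsPositive x

/-- `p` is an (orthogonal) projection belonging to the set `A` of operators. -/
def IsProjIn (A : Set (Op H)) (p : Op H) : Prop := p ∈ A ∧ star p = p ∧ p * p = p

/-- `u` is a unitary belonging to the set `A` of operators. -/
def IsUnitaryIn (A : Set (Op H)) (u : Op H) : Prop := u ∈ A ∧ star u * u = 1 ∧ u * star u = 1

/-- `v` is a partial isometry. -/
def IsPartialIsom (v : Op H) : Prop := star v * v * (star v * v) = star v * v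

/-- `φ` is a positive linear functional on `M` (recorded as a function on all of `B(H)`;
only its values on `M` matter). -/
structure IsPLF (M : VonNeumannAlgebra H) (φ : Op H → ℂ) : Prop where
  map_add : ∀ x ∈ M, ∀ y ∈ M, φ (x + y) = φ x + φ y
  map_smul : ∀ (c : ℂ), ∀ x ∈ M, φ (c • x) = c * φ x
  pos : ∀ x ∈ M, 0 ≤ φ (star x * x)

/-- `φ` is a *normal* positive linear functional on `M`: a positive linear functional which is
completely additive on orthogonal families of projections (sums taken in the strong topology). -/
structure IsNormalPLF (M : VonNeumannAlgebra H) (φ : Op H → ℂ) extends IsPLF M φ : Prop where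
  normal : ∀ (ι : Type) (p : ι → Op H) (q : Op H),
    (∀ i, IsProjIn (M : Set (Op H)) (p i)) → IsProjIn (M : Set (Op H)) q →
    (Pairwise fun i j => p i * p j = 0) →
    (∀ ξ : H, HasSum (fun i => p i ξ) (q ξ)) →
    HasSum (fun i => φ (p i)) (φ q)

/-- `φ` is a normal state on `M`. -/
def IsNormalState (M : VonNeumannAlgebra H) (φ : Op H → ℂ) : Prop :=
  IsNormalPLF M φ ∧ φ 1 = 1

/-- Faithfulness of a positive linear functional on `M`. -/
def IsFaithfulOn (M : VonNeumannAlgebra H) (φ : Op H → ℂ) : Prop :=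
  ∀ x ∈ M, φ (star x * x) = 0 → x = 0

/-- `φ` is a faithful normal state on `M`. -/
def IsFNState (M : VonNeumannAlgebra H) (φ : Op H → ℂ) : Prop :=
  IsNormalState M φ ∧ IsFaithfulOn M φ

/-- `p` is the support projection `s(φ)` of `φ` in `M`: the smallest projection of `M`
compressing to which does not change `φ`. -/
def IsSupportProjOf (M : VonNeumannAlgebra H) (φ : Op H → ℂ) (p : Op H) : Prop :=
  IsProjIn (M : Set (Op H)) p ∧ (∀ x ∈ M, φ (p * x * p) = φ x) ∧
    ∀ q, IsProjIn (M : Set (Op H)) q → (∀ x ∈ M, φ (q * x * q) = φ x) → p * q = p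

/-- `ψ ∼_M φ` : the normal positive functionals `ψ` and `φ` are intertwined in `M`,
i.e. there are a nonzero partial isometry `v ∈ s(ψ) M s(φ)` and `l > 0` with `ψ v = l v φ`
(with the bimodule conventions `(ψ v)(x) = ψ(vx)`, `(v φ)(x) = φ(xv)`). -/
def Intertwined (M : VonNeumannAlgebra H) (ψ φ : Op H → ℂ) : Prop :=
  ∃ (v q p : Op H) (l : ℝ), 0 < l ∧ v ∈ M ∧ IsPartialIsom v ∧ v ≠ 0 ∧
    IsSupportProjOf M ψ q ∧ IsSupportProjOf M φ p ∧ q * v = v ∧ v * p = v ∧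
    ∀ x ∈ M, ψ (v * x) = (l : ℂ) * φ (x * v)

/-- An automorphism of the von Neumann algebra `M` (automatically normal). -/
structure VNAut (M : VonNeumannAlgebra H) where
  toFun : Op H → Op H
  invFun : Op H → Op H
  mem' : ∀ x ∈ M, toFun x ∈ M
  inv_mem' : ∀ x ∈ M, invFun x ∈ M
  left_inv' : ∀ x ∈ M, invFun (toFun x) = x
  right_inv' : ∀ x ∈ M, toFun (invFun x) = x
  map_add' : ∀ x ∈ M, ∀ y ∈ M, toFun (x + y) = toFun x + toFun y
  map_smul' : ∀ (c : ℂ), ∀ x ∈ M, toFun (c • x) = c • toFun x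
  map_mul' : ∀ x ∈ M, ∀ y ∈ M, toFun (x * y) = toFun x * toFun y
  map_star' : ∀ x ∈ M, toFun (star x) = star (toFun x)

/-- `Θ` is pointwise inner: for every normal state `ψ` there is a unitary `u ∈ M` with
`Θ(ψ) = u ψ u*`, i.e. `ψ(Θ⁻¹(x)) = ψ(u* x u)` for all `x ∈ M`. -/
def PointwiseInner {M : VonNeumannAlgebra H} (Θ : VNAut M) : Prop :=
  ∀ ψ : Op H → ℂ, IsNormalState M ψ →
    ∃ u, IsUnitaryIn (M : Set (Op H)) u ∧
      ∀ x ∈ M, ψ (Θ.invFun x) = ψ (star u * x * u)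

/-- The closed horizontal strip `0 ≤ Im z ≤ 1`. -/
def strip : Set ℂ := {z | 0 ≤ z.im ∧ z.im ≤ 1}

/-- The open horizontal strip `0 < Im z < 1`. -/
def stripo : Set ℂ := {z | 0 < z.im ∧ z.im < 1}

/-- `σ` is the modular automorphism group `σ^φ` of the (faithful normal) state `φ` on `M`:
a pointwise SOT-continuous one-parameter group of ∗-automorphisms of `M` preserving `φ` and
satisfying the KMS condition at inverse temperature 1. -/
structure IsModularFlow (M : VonNeumannAlgebra H) (φ : Op H → ℂ) (σ : ℝ → Op H → Op H) :
    Prop where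
  mem' : ∀ (t : ℝ), ∀ x ∈ M, σ t x ∈ M
  zero' : ∀ x ∈ M, σ 0 x = x
  add' : ∀ (s t : ℝ), ∀ x ∈ M, σ (s + t) x = σ s (σ t x)
  map_add' : ∀ (t : ℝ), ∀ x ∈ M, ∀ y ∈ M, σ t (x + y) = σ t x + σ t y
  map_smul' : ∀ (t : ℝ) (c : ℂ), ∀ x ∈ M, σ t (c • x) = c • σ t x
  map_mul' : ∀ (t : ℝ), ∀ x ∈ M, ∀ y ∈ M, σ t (x * y) = σ t x * σ t y
  map_star' : ∀ (t : ℝ), ∀ x ∈ M, σ t (star x) = star (σ t x)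
  invariant' : ∀ (t : ℝ), ∀ x ∈ M, φ (σ t x) = φ x
  continuous' : ∀ x ∈ M, ∀ ξ : H, Continuous fun t : ℝ => σ t x ξ
  kms' : ∀ x ∈ M, ∀ y ∈ M, ∃ F : ℂ → ℂ, ContinuousOn F strip ∧
    DifferentiableOn ℂ F stripo ∧ (∃ C : ℝ, ∀ z ∈ strip, ‖F z‖ ≤ C) ∧
    (∀ t : ℝ, F (t : ℂ) = φ (σ t x * y)) ∧
    (∀ t : ℝ, F ((t : ℂ) + Complex.I) = φ (y * σ t x))

/-- `l ^ (i t)` for `l > 0`. -/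
noncomputable def cpowit (l t : ℝ) : ℂ := Complex.exp (Complex.I * t * Real.log l)

/-- `x ∈ M` is an `l`-eigenvector of the modular flow `σ`, i.e. `σ_t(x) = l^{it} x`. -/
def IsEigenvector (M : VonNeumannAlgebra H) (σ : ℝ → Op H → Op H) (l : ℝ) (x : Op H) :
    Prop :=
  x ∈ M ∧ ∀ t : ℝ, σ t x = cpowit l t • x

/-- The point spectrum `σ_p(Δ_φ)` of the modular operator, described via eigenvectors in `M`. -/
def pointSpectrum (M : VonNeumannAlgebra H) (σ : ℝ → Op H → Op H) : Set ℝ :=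
  {l | 0 < l ∧ ∃ x, x ≠ 0 ∧ IsEigenvector M σ l x}

/-- The linear span of the eigenvectors of the modular flow. -/
def eigenSpan (M : VonNeumannAlgebra H) (σ : ℝ → Op H → Op H) : Submodule ℂ (Op H) :=
  Submodule.span ℂ {x | ∃ l : ℝ, 0 < l ∧ IsEigenvector M σ l x}

/-- Almost periodicity of `φ` (via its modular flow `σ`): the linear span of the
eigenvectors is ∗-strongly dense in `M`. -/
def IsAlmostPeriodicFlow (M : VonNeumannAlgebra H) (σ : ℝ → Op H → Op H) : Prop :=
  ∀ x ∈ M, ∀ ε : ℝ, 0 < ε → ∀ Ξ : Finset H, ∃ y ∈ eigenSpan M σ,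
    ∀ ξ ∈ Ξ, ‖(x - y) ξ‖ < ε ∧ ‖(star x - star y) ξ‖ < ε

/-- The centralizer `M_φ` of a state `φ` on `M`. -/
def stateCentralizer (M : VonNeumannAlgebra H) (φ : Op H → ℂ) : Set (Op H) :=
  {x | x ∈ M ∧ ∀ y ∈ M, φ (x * y) = φ (y * x)}

/-- The fixed-point algebra of the flow `σ` on `M` (`= M_φ` for the modular flow of a weight). -/
def flowFixed (M : VonNeumannAlgebra H) (σ : ℝ → Op H → Op H) : Set (Op H) :=
  {x | x ∈ M ∧ ∀ t : ℝ, σ t x = x}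

/-- A set of operators (e.g. a von Neumann subalgebra) has trivial center. -/
def IsFactorSet (A : Set (Op H)) : Prop :=
  ∀ x ∈ A, (∀ y ∈ A, x * y = y * x) → ∃ c : ℂ, x = c • (1 : Op H)

/-- `M` is a factor. -/
def IsFactor (M : VonNeumannAlgebra H) : Prop := IsFactorSet (M : Set (Op H))

/-- Murray–von Neumann equivalence of projections, relative to the set `A`. -/
def MvNEquivIn (A : Set (Op H)) (p q : Op H) : Prop :=
  ∃ v ∈ A, star v * v = p ∧ v * star v = q

/-- `p` is a finite projection relative to `A`: no proper subprojection of `p`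
is Murray–von Neumann equivalent (in `A`) to `p`. -/
def IsFiniteProjIn (A : Set (Op H)) (p : Op H) : Prop :=
  ∀ q, IsProjIn A q → q * p = q → MvNEquivIn A p q → q = p

/-- `p` is a minimal projection relative to `A`. -/
def IsMinimalProjIn (A : Set (Op H)) (p : Op H) : Prop :=
  IsProjIn A p ∧ p ≠ 0 ∧ ∀ q, IsProjIn A q → q * p = q → q = 0 ∨ q = p

/-- `M` is a type III factor: a factor with no nonzero finite projection. -/
def IsTypeIIIFactor (M : VonNeumannAlgebra H) : Prop :=
  IsFactor M ∧
    ∀ p, IsProjIn (M : Set (Op H)) p → p ≠ 0 → ¬ IsFiniteProjIn (M : Set (Op H)) p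

/-- The ∗-closed set `A` (e.g. a corner or a subalgebra) is a type II₁ factor:
trivial center, `1` finite, and no minimal projections. -/
def IsTypeII1FactorSet (A : Set (Op H)) : Prop :=
  IsFactorSet A ∧ (1 : Op H) ∈ A ∧ IsFiniteProjIn A 1 ∧ ∀ p, ¬ IsMinimalProjIn A p

/-- `A` is a type I_∞ factor (model for `B(ℓ²)`): a factor with a minimal projection
whose unit is not finite. -/
def IsTypeIInfFactorSet (A : Set (Op H)) : Prop :=
  IsFactorSet A ∧ (1 : Op H) ∈ A ∧ (∃ p, IsMinimalProjIn A p) ∧ ¬ IsFiniteProjIn A 1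

/-- `M` is a type III₁ factor.  By the Connes–Størmer transitivity theorem, among
type III factors with separable predual, type III₁ is characterized by the topological
transitivity of the unitary group action on faithful normal states. -/
def IsTypeIII1Factor (M : VonNeumannAlgebra H) : Prop :=
  IsTypeIIIFactor M ∧
    ∀ φ ψ : Op H → ℂ, IsFNState M φ → IsFNState M ψ → ∀ ε : ℝ, 0 < ε →
      ∃ u, IsUnitaryIn (M : Set (Op H)) u ∧
        ∀ x ∈ M, ‖x‖ ≤ 1 → ‖φ (star u * x * u) - ψ x‖ < ε

/-- `M` is injective (= amenable, = hyperfinite by Connes' theorem):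
there is a norm-one projection `B(H) → M`. -/
def IsInjectiveVNA (M : VonNeumannAlgebra H) : Prop :=
  ∃ E : Op H →ₗ[ℂ] Op H, (∀ x, E x ∈ M) ∧ (∀ x ∈ M, E x = x) ∧ ∀ x, ‖E x‖ ≤ ‖x‖

/-- `M` is (a copy of) the Araki–Woods factor `R_∞`: the unique amenable (injective)
type III₁ factor with separable predual. -/
def IsArakiWoodsRInfty (M : VonNeumannAlgebra H) : Prop :=
  IsTypeIII1Factor M ∧ IsInjectiveVNA M

/-- Data of a faithful normal semifinite weight: its value `val` on positive elements
(in `[0,∞]`), together with a linear extension `cval` of its restriction to the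
definition ideal `m_φ` (the values of `cval` outside `m_φ` are irrelevant). -/
structure WeightData (H : Type) [NormedAddCommGroup H] [InnerProductSpace ℂ H]
    [CompleteSpace H] where
  val : Op H → ℝ≥0∞
  cval : Op H → ℂ

/-- `W` is a faithful normal semifinite weight on `M`. -/
structure IsFNSWeight (M : VonNeumannAlgebra H) (W : WeightData H) : Prop where
  map_add : ∀ x ∈ M, ∀ y ∈ M, IsPos x → IsPos y → W.val (x + y) = W.val x + W.val y
  map_smul : ∀ c : ℝ, 0 < c → ∀ x ∈ M, IsPos x →
    W.val ((c : ℂ) • x) = ENNReal.ofReal c * W.val x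
  faithful : ∀ x ∈ M, IsPos x → W.val x = 0 → x = 0
  semifinite : ∀ x ∈ M, IsPos x → x ≠ 0 →
    ∃ y ∈ M, IsPos y ∧ y ≠ 0 ∧ IsPos (x - y) ∧ W.val y ≠ ⊤
  normal : ∀ (ι : Type) (p : ι → Op H) (q : Op H),
    (∀ i, IsProjIn (M : Set (Op H)) (p i)) → IsProjIn (M : Set (Op H)) q →
    (Pairwise fun i j => p i * p j = 0) →
    (∀ ξ : H, HasSum (fun i => p i ξ) (q ξ)) →
    W.val q = ∑' i, W.val (p i)
  cval_add : ∀ x ∈ M, ∀ y ∈ M, W.cval (x + y) = W.cval x + W.cval y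
  cval_smul : ∀ (c : ℂ), ∀ x ∈ M, W.cval (c • x) = c * W.cval x
  cval_compat : ∀ x ∈ M, IsPos x → W.val x ≠ ⊤ → W.cval x = ((W.val x).toReal : ℂ)

/-- `σ` is the modular automorphism group `σ^φ` of the faithful normal semifinite
weight `W` on `M` (KMS condition required on the definition ideal). -/
structure IsModularFlowW (M : VonNeumannAlgebra H) (W : WeightData H)
    (σ : ℝ → Op H → Op H) : Prop where
  mem' : ∀ (t : ℝ), ∀ x ∈ M, σ t x ∈ M
  zero' : ∀ x ∈ M, σ 0 x = x
  add' : ∀ (s t : ℝ), ∀ x ∈ M, σ (s + t) x = σ s (σ t x)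
  map_add' : ∀ (t : ℝ), ∀ x ∈ M, ∀ y ∈ M, σ t (x + y) = σ t x + σ t y
  map_smul' : ∀ (t : ℝ) (c : ℂ), ∀ x ∈ M, σ t (c • x) = c • σ t x
  map_mul' : ∀ (t : ℝ), ∀ x ∈ M, ∀ y ∈ M, σ t (x * y) = σ t x * σ t y
  map_star' : ∀ (t : ℝ), ∀ x ∈ M, σ t (star x) = star (σ t x)
  invariant' : ∀ (t : ℝ), ∀ x ∈ M, IsPos x → W.val (σ t x) = W.val x
  continuous' : ∀ x ∈ M, ∀ ξ : H, Continuous fun t : ℝ => σ t x ξ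
  kms' : ∀ x ∈ M, ∀ y ∈ M,
    W.val (star x * x) ≠ ⊤ → W.val (x * star x) ≠ ⊤ →
    W.val (star y * y) ≠ ⊤ → W.val (y * star y) ≠ ⊤ →
    ∃ F : ℂ → ℂ, ContinuousOn F strip ∧ DifferentiableOn ℂ F stripo ∧
      (∃ C : ℝ, ∀ z ∈ strip, ‖F z‖ ≤ C) ∧
      (∀ t : ℝ, F (t : ℂ) = W.cval (σ t x * y)) ∧
      (∀ t : ℝ, F ((t : ℂ) + Complex.I) = W.cval (y * σ t x))

/-- The weight `W` is strictly semifinite: its restriction to the centralizer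
(= fixed points of the modular flow `σ`) is semifinite. -/
def IsStrictlySemifiniteOn (M : VonNeumannAlgebra H) (W : WeightData H)
    (σ : ℝ → Op H → Op H) : Prop :=
  ∀ x ∈ flowFixed M σ, IsPos x → x ≠ 0 →
    ∃ y ∈ flowFixed M σ, IsPos y ∧ y ≠ 0 ∧ IsPos (x - y) ∧ W.val y ≠ ⊤

/-- `h` is a positive element of the corner `pAp`, invertible in this corner. -/
def CornerPosInvertibleIn (A : Set (Op H)) (p h : Op H) : Prop :=
  h ∈ A ∧ IsPos h ∧ p * h = h ∧ h * p = h ∧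
    ∃ h' ∈ A, p * h' = h' ∧ h' * p = h' ∧ h * h' = p ∧ h' * h = p

/-- `Θ` is locally pointwise inner for the strictly semifinite weight `W` (with modular flow
`σ`): `Θ(φ) = φ`, and for every nonzero projection `p ∈ M_φ` with `φ(p) < ∞` and every
positive invertible `h ∈ pM_φp` one has `Θ(φ_h) ∼_M φ_h`, where `φ_h = φ(h^{1/2}·h^{1/2})`
(below `k = h^{1/2}` is the positive square root of `h` in `M_φ`). -/
def LocallyPointwiseInnerW {M : VonNeumannAlgebra H} (W : WeightData H)
    (σ : ℝ → Op H → Op H) (Θ : VNAut M) : Prop :=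
  (∀ x ∈ M, IsPos x → W.val (Θ.invFun x) = W.val x) ∧
  ∀ p, IsProjIn (flowFixed M σ) p → p ≠ 0 → W.val p ≠ ⊤ →
  ∀ h, CornerPosInvertibleIn (flowFixed M σ) p h →
  ∀ k, k ∈ flowFixed M σ → IsPos k → k * k = h →
    Intertwined M (fun x => W.cval (k * Θ.invFun x * k)) (fun x => W.cval (k * x * k))

/-- `Θ` is locally pointwise inner for the faithful normal state `φ` with modular flow `σ`. -/
def LocallyPointwiseInnerS {M : VonNeumannAlgebra H} (φ : Op H → ℂ)
    (σ : ℝ → Op H → Op H) (Θ : VNAut M) : Prop :=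
  (∀ x ∈ M, φ (Θ.invFun x) = φ x) ∧
  ∀ p, IsProjIn (flowFixed M σ) p → p ≠ 0 →
  ∀ h, CornerPosInvertibleIn (flowFixed M σ) p h →
  ∀ k, k ∈ flowFixed M σ → IsPos k → k * k = h →
    Intertwined M (fun x => φ (k * Θ.invFun x * k)) (fun x => φ (k * x * k))

/-- `Θ` is locally pointwise inner for the faithful normal state `φ`, stated with the
algebraically-defined centralizer `M_φ = {x : φ(xy) = φ(yx)}`. -/
def LocallyPointwiseInnerC {M : VonNeumannAlgebra H} (φ : Op H → ℂ) (Θ : VNAut M) : Prop :=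
  (∀ x ∈ M, φ (Θ.invFun x) = φ x) ∧
  ∀ p, IsProjIn (stateCentralizer M φ) p → p ≠ 0 →
  ∀ h, CornerPosInvertibleIn (stateCentralizer M φ) p h →
  ∀ k, k ∈ stateCentralizer M φ → IsPos k → k * k = h →
    Intertwined M (fun x => φ (k * Θ.invFun x * k)) (fun x => φ (k * x * k))

/-- `E : M → N` is a faithful normal conditional expectation. -/
structure IsCondExp (M N : VonNeumannAlgebra H) (E : Op H → Op H) : Prop where
  subset' : (N : Set (Op H)) ⊆ (M : Set (Op H))
  mem' : ∀ x ∈ M, E x ∈ N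
  fix' : ∀ x ∈ N, E x = x
  map_add' : ∀ x ∈ M, ∀ y ∈ M, E (x + y) = E x + E y
  map_smul' : ∀ (c : ℂ), ∀ x ∈ M, E (c • x) = c • E x
  bimod' : ∀ a ∈ N, ∀ x ∈ M, ∀ b ∈ N, E (a * x * b) = a * E x * b
  map_star' : ∀ x ∈ M, E (star x) = star (E x)
  pos' : ∀ x ∈ M, IsPos x → IsPos (E x)
  faithful' : ∀ x ∈ M, IsPos x → E x = 0 → x = 0
  normal' : ∀ ρ : Op H → ℂ, IsNormalState N ρ → IsNormalState M (fun x => ρ (E x))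

/-- The triple `(M, N, φ)` (with expectation `E : M → N`, `φ ∘ E = φ`) is
intertwining stable (Definition 4.1 of Houdayer–Isono). -/
def IntertwiningStable (M N : VonNeumannAlgebra H) (E : Op H → Op H)
    (φ : Op H → ℂ) : Prop :=
  ∀ Θ : VNAut M,
    (∀ x ∈ M, E (Θ.toFun x) = Θ.toFun (E x)) →
    (∀ x ∈ M, φ (Θ.invFun x) = φ x) →
    ∀ ψ : Op H → ℂ, IsNormalPLF N ψ → (∃ x ∈ N, ψ x ≠ 0) →
      Intertwined M (fun x => ψ (E (Θ.invFun x))) (fun x => ψ (E x)) →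
      Intertwined N (fun x => ψ (Θ.invFun x)) ψ

/-- `M = N ⊗̄ P`: `N` and `P` are commuting subalgebras of `M` which generate `M`
and admit normal product states (slice maps). -/
structure IsTensorDecomposition (M N P : VonNeumannAlgebra H) : Prop where
  subN : (N : Set (Op H)) ⊆ (M : Set (Op H))
  subP : (P : Set (Op H)) ⊆ (M : Set (Op H))
  comm : ∀ x ∈ N, ∀ y ∈ P, x * y = y * x
  generates :
    Set.centralizer (Set.centralizer ((N : Set (Op H)) ∪ (P : Set (Op H)))) = (M : Set (Op H))
  slice : ∀ (ρN ρP : Op H → ℂ), IsNormalState N ρN → IsNormalState P ρP →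
    ∃ ρ : Op H → ℂ, IsNormalState M ρ ∧ ∀ x ∈ N, ∀ y ∈ P, ρ (x * y) = ρN x * ρP y

/-- `E = id_N ⊗ φ_P : N ⊗̄ P → N` is the slice conditional expectation attached to `φ_P`. -/
def IsSliceExpectation (M N P : VonNeumannAlgebra H) (φP : Op H → ℂ)
    (E : Op H → Op H) : Prop :=
  IsCondExp M N E ∧ ∀ x ∈ N, ∀ y ∈ P, E (x * y) = φP y • x

/-- `(M, φ) = (N, φN) ∗ (P, φP)`: `N` and `P` are subalgebras of `M` which generate `M`,
the state `φ` restricts to `φN`, `φP`, and `N`, `P` are free with respect to `φ`. -/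
structure IsFreeProductDecomposition (M N P : VonNeumannAlgebra H)
    (φ φN φP : Op H → ℂ) : Prop where
  subN : (N : Set (Op H)) ⊆ (M : Set (Op H))
  subP : (P : Set (Op H)) ⊆ (M : Set (Op H))
  generates :
    Set.centralizer (Set.centralizer ((N : Set (Op H)) ∪ (P : Set (Op H)))) = (M : Set (Op H))
  restN : ∀ x ∈ N, φ x = φN x
  restP : ∀ x ∈ P, φ x = φP x
  free : ∀ (n : ℕ) (x : Fin n → Op H) (ε : Fin n → Bool), n ≠ 0 →
    (∀ i, x i ∈ (if ε i then (N : Set (Op H)) else (P : Set (Op H)))) →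
    (∀ i, φ (x i) = 0) →
    (∀ i j : Fin n, (i : ℕ) + 1 = (j : ℕ) → ε i ≠ ε j) →
    φ (List.ofFn x).prod = 0

/-- `f` restricts to a ∗-isomorphism `N ≅ P`. -/
structure IsVNIso (N P : VonNeumannAlgebra H) (f : Op H → Op H) : Prop where
  mem' : ∀ x ∈ N, f x ∈ P
  surj' : ∀ y ∈ P, ∃ x ∈ N, f x = y
  inj' : ∀ x ∈ N, ∀ y ∈ N, f x = f y → x = y
  map_add' : ∀ x ∈ N, ∀ y ∈ N, f (x + y) = f x + f y
  map_smul' : ∀ (c : ℂ), ∀ x ∈ N, f (c • x) = c • f x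
  map_mul' : ∀ x ∈ N, ∀ y ∈ N, f (x * y) = f x * f y
  map_star' : ∀ x ∈ N, f (star x) = star (f x)

/-- `M` satisfies the Haagerup–Størmer conjecture: an automorphism of `M` is pointwise
inner iff it is the composition of an inner automorphism and a modular automorphism
`σ_t^χ` of some faithful normal state `χ`. -/
def SatisfiesHSC (M : VonNeumannAlgebra H) : Prop :=
  ∀ Θ : VNAut M, PointwiseInner Θ ↔
    ∃ (χ : Op H → ℂ) (σ : ℝ → Op H → Op H) (u : Op H) (t : ℝ),
      IsFNState M χ ∧ IsModularFlow M χ σ ∧ IsUnitaryIn (M : Set (Op H)) u ∧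
      ∀ x ∈ M, Θ.toFun x = u * σ t x * star u

/-- `Λ` is a countable subgroup of `ℝ_{>0}`, dense in `ℝ_{>0}`. -/
def IsCountableDenseSubgroup (Λ : Set ℝ) : Prop :=
  Λ ⊆ Set.Ioi (0 : ℝ) ∧ (1 : ℝ) ∈ Λ ∧ (∀ a ∈ Λ, ∀ b ∈ Λ, a * b ∈ Λ) ∧
    (∀ a ∈ Λ, a⁻¹ ∈ Λ) ∧ Λ.Countable ∧ Set.Ioi (0 : ℝ) ⊆ closure Λ

/-- `g` is a character of the (discrete) group `Λ < ℝ_{>0}`, i.e. an element of the dual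
compact group `G = Λ̂` (only the values of `g` on `Λ` are relevant). -/
def IsCharacterOn (Λ : Set ℝ) (g : ℝ → ℂ) : Prop :=
  g 1 = 1 ∧ (∀ a ∈ Λ, ‖g a‖ = 1) ∧ ∀ a ∈ Λ, ∀ b ∈ Λ, g (a * b) = g a * g b

/-- `Φ ∈ E_{M,φ}`: `Φ` is a faithful normal positive linear functional with
`s(φ) ∈ M_Φ` and `Φ s(φ) = s(φ) Φ = φ`. -/
def MemE (M : VonNeumannAlgebra H) (φ Φ : Op H → ℂ) : Prop :=
  IsNormalPLF M Φ ∧ IsFaithfulOn M Φ ∧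
    ∃ p, IsSupportProjOf M φ p ∧ (∀ x ∈ M, Φ (p * x) = Φ (x * p)) ∧
      ∀ x ∈ M, Φ (p * x) = φ x

/-- `w = ([DΨ : DΦ]_t)_t` is the Connes Radon–Nikodym cocycle of the pair `(Ψ, Φ)` of
faithful normal positive functionals (with `σΦ` the modular flow of `Φ`): the unique
σ-strongly continuous family of unitaries satisfying the cocycle identity and the
relative KMS condition. -/
structure IsConnesCocycle (M : VonNeumannAlgebra H) (Φ Ψ : Op H → ℂ)
    (σΦ : ℝ → Op H → Op H) (w : ℝ → Op H) : Prop where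
  unitary' : ∀ t : ℝ, IsUnitaryIn (M : Set (Op H)) (w t)
  cocycle' : ∀ s t : ℝ, w (s + t) = w s * σΦ s (w t)
  continuous' : ∀ ξ : H, Continuous fun t : ℝ => w t ξ
  kms' : ∀ x ∈ M, ∀ y ∈ M, ∃ F : ℂ → ℂ, ContinuousOn F strip ∧
    DifferentiableOn ℂ F stripo ∧ (∃ C : ℝ, ∀ z ∈ strip, ‖F z‖ ≤ C) ∧
    (∀ t : ℝ, F (t : ℂ) = Ψ (w t * σΦ t x * y)) ∧
    (∀ t : ℝ, F ((t : ℂ) + Complex.I) = Φ (y * (w t * σΦ t x)))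

/-- `S` is a strongly dense subset of `M`. -/
def StronglyDenseIn (M : VonNeumannAlgebra H) (S : Set (Op H)) : Prop :=
  S ⊆ (M : Set (Op H)) ∧ ∀ x ∈ M, ∀ ε : ℝ, 0 < ε → ∀ Ξ : Finset H,
    ∃ y ∈ S, ∀ ξ ∈ Ξ, ‖(x - y) ξ‖ < ε

/-- There is a net `(t_j)` in `ℝ` along which `φ(σ_{t_j}^Φ(b^*) w_{t_j}^* s(ψ) a) → 0`
for all `a, b ∈ S` (nets are encoded by maps out of a nontrivially filtered index type). -/
def VanishingNet (φ : Op H → ℂ) (σΦ : ℝ → Op H → Op H) (w : ℝ → Op H)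
    (sψ : Op H) (S : Set (Op H)) : Prop :=
  ∃ (ι : Type) (l : Filter ι), l.NeBot ∧ ∃ t : ι → ℝ,
    ∀ a ∈ S, ∀ b ∈ S,
      Filter.Tendsto (fun j => φ (σΦ (t j) (star b) * (star (w (t j)) * (sψ * a))))
        l (nhds (0 : ℂ))

/-- `(D, π, lam)` is the discrete core `d_{Λ,φ}(M) = M ⋊_{σ^{Λ,φ}} G` of `(M, φ)` with
respect to `Λ = σ_p(Δ_φ)` and `G = Λ̂`: `π` is a normal unital ∗-embedding of `M` into `D`,
`lam` implements `G` by unitaries of `D` satisfying the covariance relation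
`λ_g π(x) λ_g^* = ⟨g, l⟩ π(x)` on `l`-eigenvectors, and `π(M)` together with the `λ_g`
generate `D`. -/
structure IsDiscreteCore {K : Type} [NormedAddCommGroup K] [InnerProductSpace ℂ K]
    [CompleteSpace K] (M : VonNeumannAlgebra H) (σ : ℝ → Op H → Op H)
    (D : VonNeumannAlgebra K) (π : Op H → Op K) (lam : (ℝ → ℂ) → Op K) : Prop where
  mem' : ∀ x ∈ M, π x ∈ D
  inj' : ∀ x ∈ M, ∀ y ∈ M, π x = π y → x = y
  map_one' : π 1 = 1
  map_add' : ∀ x ∈ M, ∀ y ∈ M, π (x + y) = π x + π y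
  map_smul' : ∀ (c : ℂ), ∀ x ∈ M, π (c • x) = c • π x
  map_mul' : ∀ x ∈ M, ∀ y ∈ M, π (x * y) = π x * π y
  map_star' : ∀ x ∈ M, π (star x) = star (π x)
  lam_unitary' : ∀ g, IsCharacterOn (pointSpectrum M σ) g →
    IsUnitaryIn (D : Set (Op K)) (lam g)
  lam_one' : lam (fun _ => 1) = 1
  lam_mul' : ∀ g h, IsCharacterOn (pointSpectrum M σ) g →
    IsCharacterOn (pointSpectrum M σ) h → lam (fun r => g r * h r) = lam g * lam h
  covariance' : ∀ g, IsCharacterOn (pointSpectrum M σ) g →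
    ∀ l ∈ pointSpectrum M σ, ∀ x, IsEigenvector M σ l x →
      lam g * π x * star (lam g) = g l • π x
  generates' : Set.centralizer (Set.centralizer
      ((π '' (M : Set (Op H))) ∪ (lam '' {g | IsCharacterOn (pointSpectrum M σ) g})))
    = (D : Set (Op K))

/-! ### Bounded analytic functions on the strip -/

/-- A bounded analytic function on the strip which is constant on the real line takes the same
value at `I`. -/
theorem strip_eq_of_const {F : ℂ → ℂ} (hc : ContinuousOn F strip)
    (hd : DifferentiableOn ℂ F stripo) (hb : ∃ C : ℝ, ∀ z ∈ strip, ‖F z‖ ≤ C) {c : ℂ}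
    (h0 : ∀ t : ℝ, F t = c) : F Complex.I = c := by
  obtain ⟨C, hC⟩ := hb
  have hcl : closure (Complex.HadamardThreeLines.verticalStrip 0 1) =
      Complex.HadamardThreeLines.verticalClosedStrip 0 1 := by
    simp only [Complex.HadamardThreeLines.verticalStrip,
      Complex.HadamardThreeLines.verticalClosedStrip]
    rw [Complex.closure_preimage_re, closure_Ioo zero_ne_one]
  have hmap : ∀ z ∈ Complex.HadamardThreeLines.verticalClosedStrip 0 1,
      z * Complex.I ∈ strip := by
    intro z hz
    simpa [strip, Complex.HadamardThreeLines.verticalClosedStrip] using hz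
  have hmapo : ∀ z ∈ Complex.HadamardThreeLines.verticalStrip 0 1,
      z * Complex.I ∈ stripo := by
    intro z hz
    simpa [stripo, Complex.HadamardThreeLines.verticalStrip] using hz
  let G : ℂ → ℂ := fun z => F (z * Complex.I) - c
  have hG : DiffContOnCl ℂ G (Complex.HadamardThreeLines.verticalStrip 0 1) := by
    constructor
    · refine DifferentiableOn.sub_const ?_ c
      exact hd.comp (by fun_prop) hmapo
    · rw [hcl]
      exact (hc.comp (by fun_prop) hmap).sub continuousOn_const
  have hbd : ∀ z ∈ Complex.HadamardThreeLines.verticalClosedStrip 0 1, ‖G z‖ ≤ C + ‖c‖ :=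
    fun z hz => (norm_sub_le _ _).trans (by gcongr; exact hC _ (hmap z hz))
  have hzero : ∀ y : ℝ, y ∈ Set.Ico (0 : ℝ) 1 → F (y * Complex.I) = c := by
    intro y hy
    have hz : (y : ℂ) ∈ Complex.HadamardThreeLines.verticalClosedStrip 0 1 := by
      simp [Complex.HadamardThreeLines.verticalClosedStrip, hy.1, hy.2.le]
    have := Complex.HadamardThreeLines.norm_le_interp_of_mem_verticalClosedStrip₀₁' G
      (a := 0) (b := C + ‖c‖) hz hG ⟨C + ‖c‖, by rintro _ ⟨z, hz, rfl⟩; exact hbd z hz⟩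
      (by
        intro z hz
        have hz' : z * Complex.I = ((-z.im : ℝ) : ℂ) := by
          apply Complex.ext <;> simp_all
        simp only [G, hz', h0, sub_self, norm_zero, le_refl])
      (by
        intro z hz
        refine hbd z ?_
        simp_all [Complex.HadamardThreeLines.verticalClosedStrip])
    rw [Complex.ofReal_re, Real.zero_rpow (by linarith [hy.2]), zero_mul] at this
    exact sub_eq_zero.mp (norm_le_zero_iff.mp this)
  have hIm : Complex.I ∈ strip := by simp [strip]
  have ht : Filter.Tendsto (fun y : ℝ => F (y * Complex.I)) (nhdsWithin 1 (Set.Ico 0 1))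
      (nhds (F Complex.I)) := by
    have h1 := (hc Complex.I hIm).tendsto
    refine h1.comp (tendsto_nhdsWithin_iff.mpr ⟨?_, ?_⟩)
    · have : Continuous fun y : ℝ => (y : ℂ) * Complex.I := by fun_prop
      simpa using (this.tendsto 1).mono_left nhdsWithin_le_nhds
    · filter_upwards [self_mem_nhdsWithin] with y hy
      simp [strip, hy.1, hy.2.le]
  have hne : (nhdsWithin (1 : ℝ) (Set.Ico 0 1)).NeBot :=
    mem_closure_iff_nhdsWithin_neBot.mp (by rw [closure_Ico zero_ne_one]; simp)
  refine tendsto_nhds_unique ht (tendsto_const_nhds.congr' ?_)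
  filter_upwards [self_mem_nhdsWithin] with y hy
  exact (hzero y hy).symm

/-- The integrals of an `I`-periodic analytic function over the vertical sides of the strip
agree. -/
theorem strip_integral_eq {G : ℂ → ℂ} (hc : ContinuousOn G strip)
    (hd : DifferentiableOn ℂ G stripo) (hper : ∀ t : ℝ, G (t + Complex.I) = G t) (a b : ℝ) :
    ∫ s in (0 : ℝ)..1, G (b + s * Complex.I) = ∫ s in (0 : ℝ)..1, G (a + s * Complex.I) := by
  have := Complex.integral_boundary_rect_eq_zero_of_continuousOn_of_differentiableOn G
    (a : ℂ) (b + Complex.I) (hc.mono ?_) (hd.mono ?_)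
  · simp only [Complex.ofReal_im, Complex.ofReal_re, Complex.add_re, Complex.I_re, add_zero,
      Complex.add_im, Complex.I_im, zero_add, Complex.ofReal_zero, zero_mul, Complex.ofReal_one,
      one_mul, hper, sub_self, smul_eq_mul] at this
    rw [← mul_sub] at this
    exact sub_eq_zero.mp ((mul_eq_zero.mp this).resolve_left Complex.I_ne_zero)
  · rintro z ⟨-, hz⟩
    simpa [strip, Set.uIcc_of_le] using hz
  · rintro z ⟨-, hz⟩
    simpa [stripo] using hz

/-- A bounded `I`-periodic analytic function on the strip is constant on the real line. -/
theorem strip_const_of_periodic {F : ℂ → ℂ} (hc : ContinuousOn F strip)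
    (hd : DifferentiableOn ℂ F stripo) (hb : ∃ C : ℝ, ∀ z ∈ strip, ‖F z‖ ≤ C)
    (hper : ∀ t : ℝ, F (t + Complex.I) = F t) (a b : ℝ) : F a = F b := by
  obtain ⟨C, hC⟩ := hb
  have hmem : ∀ b s : ℝ, s ∈ Set.Icc (0 : ℝ) 1 → (b + s * Complex.I : ℂ) ∈ strip := by
    intro b s hs
    simpa [strip] using hs
  let J : ℤ → ℝ → ℂ := fun n b =>
    ∫ s in (0 : ℝ)..1, Complex.exp (-(2 * Real.pi * Complex.I * n * s)) * F (b + s * Complex.I)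
  have hJ : ∀ (n : ℤ) (a b : ℝ), Complex.exp (-(2 * Real.pi * n * b)) * J n b =
      Complex.exp (-(2 * Real.pi * n * a)) * J n a := by
    intro n a b
    have := strip_integral_eq (G := fun z => Complex.exp (-(2 * Real.pi * n * z)) * F z)
      (ContinuousOn.mul (by fun_prop) hc) (DifferentiableOn.mul (by fun_prop) hd)
      (by
        intro t
        rw [hper]
        congr 1
        rw [Complex.exp_eq_exp_iff_exists_int]
        exact ⟨-n, by push_cast; ring⟩) a b
    simp only [J, ← intervalIntegral.integral_const_mul]
    convert! this using 2 with s _ s <;>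
    · funext s
      rw [← mul_assoc, ← Complex.exp_add]
      congr 2
      ring
  have hJb : ∀ n b, ‖J n b‖ ≤ C := by
    intro n b
    have := intervalIntegral.norm_integral_le_of_norm_le_const (a := 0) (b := 1) (C := C)
      (f := fun s : ℝ =>
        Complex.exp (-(2 * Real.pi * Complex.I * n * s)) * F (b + s * Complex.I)) ?_
    · simpa using this
    · intro s hs
      rw [Set.uIoc_of_le zero_le_one] at hs
      rw [norm_mul, Complex.norm_exp]
      simpa using hC _ (hmem b s ⟨hs.1.le, hs.2⟩)
  have hJ0 : ∀ n, n ≠ 0 → ∀ a, J n a = 0 := by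
    intro n hn a
    have h1 : ∀ b : ℝ, ‖J n a‖ ≤ Real.exp (2 * Real.pi * n * (a - b)) * C := by
      intro b
      have h2 : J n a = Complex.exp (2 * Real.pi * n * (a - b)) * J n b := by
        have h3 : Complex.exp (2 * Real.pi * n * (a - b)) =
          Complex.exp (2 * Real.pi * n * a) * Complex.exp (-(2 * Real.pi * n * b)) := by
          rw [← Complex.exp_add]; congr 1; ring
        rw [h3, mul_assoc, hJ n a b, ← mul_assoc, ← Complex.exp_add]
        simp
      rw [h2, norm_mul, Complex.norm_exp]
      have : (2 * Real.pi * n * (a - b) : ℂ).re = 2 * Real.pi * n * (a - b) := by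
        rw [← Complex.ofReal_re (2 * Real.pi * n * (a - b))]
        push_cast; rfl
      rw [this]
      gcongr
      exact hJb n b
    have h4 : Filter.Tendsto (fun m : ℝ => Real.exp (-m) * C) Filter.atTop (nhds (0 * C)) :=
      (Real.tendsto_exp_neg_atTop_nhds_zero).mul_const C
    rw [zero_mul] at h4
    refine norm_le_zero_iff.mp (ge_of_tendsto' h4 fun m => ?_)
    have h5 := h1 (a + m / (2 * Real.pi * n))
    have hn' : (n : ℝ) ≠ 0 := by exact_mod_cast hn
    have h6 : 2 * Real.pi * n * (a - (a + m / (2 * Real.pi * n))) = -m := by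
      have := Real.pi_ne_zero
      field_simp
      ring
    rwa [h6] at h5
  have : Fact ((0 : ℝ) < 1) := ⟨one_pos⟩
  have key : ∀ b : ℝ, F b = J 0 b := by
    intro b
    let f : ℝ → ℂ := fun s => F (b + s * Complex.I)
    have hfc : ContinuousOn f (Set.Icc 0 1) := hc.comp (by fun_prop) (hmem b)
    have hf01 : f 0 = f 1 := by simp [f, hper]
    let g : C(AddCircle (1 : ℝ), ℂ) :=
      ⟨AddCircle.liftIco 1 0 f, AddCircle.liftIco_zero_continuous hf01 hfc⟩
    have hcoef : ∀ n, fourierCoeff g n = J n b := by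
      intro n
      have h1 : fourierCoeff g n = fourierCoeff (AddCircle.liftIco 1 0 f) n := rfl
      rw [h1, fourierCoeff_liftIco_eq, fourierCoeffOn_eq_integral]
      simp only [fourier_coe_apply]
      simp only [J, f, zero_add, sub_zero, div_one, one_smul, smul_eq_mul, Complex.ofReal_one]
      congr 1
      funext s
      congr 2
      push_cast
      ring
    have hsupp : ∀ n, n ≠ 0 → fourierCoeff g n = 0 := fun n hn => by rw [hcoef, hJ0 n hn]
    have hsum : Summable (fourierCoeff g) :=
      summable_of_ne_finset_zero (s := {0}) fun n hn => hsupp n (by simpa using hn)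
    have h1 := has_pointwise_sum_fourier_series_of_summable hsum ((0 : ℝ) : AddCircle (1 : ℝ))
    have h2 := hasSum_single (f := fun i => fourierCoeff g i •
      fourier i ((0 : ℝ) : AddCircle (1 : ℝ))) 0 fun n hn => by
        simp only [hsupp n hn, zero_smul]
    have h3 := h1.unique h2
    have h4 : g ((0 : ℝ) : AddCircle (1 : ℝ)) = f 0 :=
      AddCircle.liftIco_coe_apply (p := 1) (a := 0) (f := f) (x := 0) (by simp)
    rw [h4, hcoef] at h3
    simpa [f] using h3
  have h7 := hJ 0 a b
  simp at h7
  rw [key a, key b, h7]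

/-! ### Projections in a von Neumann algebra -/

theorem mem_of_forall_commutant {N : VonNeumannAlgebra H} {x : Op H}
    (h : ∀ y ∈ N.commutant, y * x = x * y) : x ∈ N := by
  rw [← N.commutant_commutant, VonNeumannAlgebra.mem_commutant_iff]
  exact h

theorem commute_of_mem_commutant {N : VonNeumannAlgebra H} {x y : Op H} (hx : x ∈ N)
    (hy : y ∈ N.commutant) : x * y = y * x :=
  VonNeumannAlgebra.mem_commutant_iff.mp hy x hx

theorem posPart_mem {N : VonNeumannAlgebra H} {x : Op H} (hx : x ∈ N) : x⁺ ∈ N := by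
  refine mem_of_forall_commutant fun y hy => ?_
  rw [CFC.posPart_def]
  exact (Commute.cfcₙ_real (commute_of_mem_commutant hx hy) _).symm

theorem sqrt_mem {N : VonNeumannAlgebra H} {x : Op H} (hx : x ∈ N) : CFC.sqrt x ∈ N := by
  refine mem_of_forall_commutant fun y hy => ?_
  exact (Commute.cfcₙ_nnreal (commute_of_mem_commutant hx hy) _).symm

theorem smul_mem_vna {N : VonNeumannAlgebra H} (c : ℂ) {x : Op H} (hx : x ∈ N) : c • x ∈ N :=
  N.toStarSubalgebra.smul_mem hx c

theorem isPos_iff {x : Op H} : IsPos x ↔ 0 ≤ x :=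
  (ContinuousLinearMap.nonneg_iff_isPositive x).symm

theorem IsProjIn.nonneg {A : Set (Op H)} {p : Op H} (hp : IsProjIn A p) : 0 ≤ p := by
  have := star_mul_self_nonneg p
  rwa [hp.2.1, hp.2.2] at this

theorem IsProjIn.one_sub {N : VonNeumannAlgebra H} {p : Op H}
    (hp : IsProjIn (N : Set (Op H)) p) : IsProjIn (N : Set (Op H)) (1 - p) := by
  refine ⟨sub_mem (one_mem N) hp.1, by simp [hp.2.1], ?_⟩
  simp [mul_sub, sub_mul, hp.2.2]

theorem IsProjIn.mul_eq_of_le {A B : Set (Op H)} {p f : Op H} (hp : IsProjIn A p)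
    (hf : IsProjIn B f) (h : p * f = f) : f * p = f := by
  have := congrArg star h
  rwa [star_mul, hp.2.1, hf.2.1] at this

theorem IsProjIn.sub {N : VonNeumannAlgebra H} {p f : Op H}
    (hp : IsProjIn (N : Set (Op H)) p) (hf : IsProjIn (N : Set (Op H)) f) (h : p * f = f) :
    IsProjIn (N : Set (Op H)) (p - f) := by
  refine ⟨sub_mem hp.1 hf.1, by simp [hp.2.1, hf.2.1], ?_⟩
  simp [mul_sub, sub_mul, hp.2.2, hf.2.2, h, hp.mul_eq_of_le hf h]

theorem IsProjIn.le_one {N : VonNeumannAlgebra H} {p : Op H}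
    (hp : IsProjIn (N : Set (Op H)) p) : p ≤ 1 :=
  sub_nonneg.mp hp.one_sub.nonneg

/-- The range projection of an element of a von Neumann algebra. -/
theorem exists_range_proj {N : VonNeumannAlgebra H} {a : Op H} (ha : a ∈ N) :
    ∃ e, IsProjIn (N : Set (Op H)) e ∧ e * a = a ∧ ∀ b : Op H, b * a = 0 → b * e = 0 := by
  let U : Submodule ℂ H := a.range.topologicalClosure
  have : CompleteSpace U := a.range.isClosed_topologicalClosure.completeSpace_coe
  have hU : ∀ y ∈ N.commutant, ∀ ξ ∈ U, y ξ ∈ U := by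
    intro y hy ξ hξ
    have hmap : Set.MapsTo y (a.range : Set H) (a.range : Set H) := by
      rintro _ ⟨η, rfl⟩
      refine ⟨y η, ?_⟩
      exact congrArg (fun T : Op H => T η) (commute_of_mem_commutant ha hy)
    exact hmap.closure y.continuous hξ
  have hproj : IsStarProjection U.starProjection := isStarProjection_starProjection
  have h1 : ∀ y ∈ N.commutant, U.starProjection * y * U.starProjection =
      y * U.starProjection := by
    intro y hy
    ext ξ
    exact Submodule.starProjection_eq_self_iff.mpr
      (hU y hy _ (Submodule.starProjection_apply_mem U ξ))
  refine ⟨U.starProjection, ⟨?_, hproj.2, hproj.1⟩, ?_, ?_⟩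
  · refine mem_of_forall_commutant fun y hy => ?_
    have h2 := congrArg star (h1 (star y) (star_mem hy))
    simp only [star_mul, star_star, hproj.2.star_eq] at h2
    exact (h1 y hy).symm.trans (by rw [mul_assoc]; exact h2)
  · ext ξ
    exact Submodule.starProjection_eq_self_iff.mpr
      (Submodule.le_topologicalClosure _ ⟨ξ, rfl⟩)
  · intro b hb
    have hker : Set.MapsTo b (a.range : Set H) {0} := by
      rintro _ ⟨η, rfl⟩
      exact congrArg (fun T : Op H => T η) hb
    ext ξ
    have := hker.closure b.continuous (Submodule.starProjection_apply_mem U ξ)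
    simpa using this

/-- Orthogonal projections in a von Neumann algebra have a strong sum. -/
theorem exists_sum_proj {N : VonNeumannAlgebra H} {ι : Type} {p : ι → Op H}
    (hp : ∀ i, IsProjIn (N : Set (Op H)) (p i)) (horth : Pairwise fun i j => p i * p j = 0) :
    ∃ g, IsProjIn (N : Set (Op H)) g ∧ (∀ ξ : H, HasSum (fun i => p i ξ) (g ξ)) := by
  classical
  let s : Finset ι → Op H := fun F => ∑ i ∈ F, p i
  have hmul : ∀ F G : Finset ι, F ⊆ G → s G * s F = s F := by
    intro F G hFG
    simp only [s, Finset.mul_sum]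
    refine Finset.sum_congr rfl fun i hi => ?_
    rw [Finset.sum_mul, Finset.sum_eq_single i (fun j _ hj => horth hj)
      (fun h => absurd (hFG hi) h), (hp i).2.2]
  have hstar : ∀ F, IsStarProjection (s F) := fun F =>
    ⟨hmul F F (Finset.Subset.refl F), by
      simp only [IsSelfAdjoint, s, star_sum]
      exact Finset.sum_congr rfl fun i _ => (hp i).2.1⟩
  have hs := fun F => isStarProjection_iff_eq_starProjection_range.mp (hstar F)
  let U : Finset ι → Submodule ℂ H := fun F => (s F).range
  have hUi : ∀ F, (U F).HasOrthogonalProjection := fun F => (hs F).choose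
  have hUs : ∀ F, s F = (U F).starProjection := fun F => (hs F).choose_spec
  have : CompleteSpace (⨆ F, U F).topologicalClosure :=
    (⨆ F, U F).isClosed_topologicalClosure.completeSpace_coe
  have hmono : Monotone U := by
    rintro F G hFG _ ⟨ξ, rfl⟩
    refine ⟨s F ξ, ?_⟩
    exact congrArg (fun T : Op H => T ξ) (hmul F G hFG)
  have hsum : ∀ ξ : H, HasSum (fun i => p i ξ)
      ((⨆ F, U F).topologicalClosure.starProjection ξ) := by
    intro ξ
    have := Submodule.starProjection_tendsto_closure_iSup U hmono ξ
    simp only [← hUs] at this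
    simpa [HasSum, s] using this
  have hproj : IsStarProjection (⨆ F, U F).topologicalClosure.starProjection :=
    isStarProjection_starProjection
  refine ⟨_, ⟨mem_of_forall_commutant fun y hy => ?_, hproj.2, hproj.1⟩, hsum⟩
  ext ξ
  have h1 := (hsum ξ).mapL y
  have h2 := hsum (y ξ)
  have h3 : (fun i => y (p i ξ)) = fun i => p i (y ξ) := funext fun i =>
    (congrArg (fun T : Op H => T ξ) (commute_of_mem_commutant (hp i).1 hy)).symm
  rw [h3] at h1
  exact h1.unique h2

theorem mul_eq_of_hasSum {ι : Type} {p : ι → Op H} {g e : Op H}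
    (hsum : ∀ ξ : H, HasSum (fun i => p i ξ) (g ξ)) (h : ∀ i, e * p i = p i) : e * g = g := by
  ext ξ
  refine ((hsum ξ).mapL e).unique ?_
  convert! hsum ξ using 2 with i
  exact congrArg (fun T : Op H => T ξ) (h i)

theorem mul_eq_self_of_hasSum {A : Set (Op H)} {ι : Type} {p : ι → Op H} {g : Op H}
    (hp : ∀ i, IsProjIn A (p i)) (horth : Pairwise fun i j => p i * p j = 0)
    (hsum : ∀ ξ : H, HasSum (fun i => p i ξ) (g ξ)) (i : ι) : g * p i = p i := by
  ext ξ
  refine (hsum (p i ξ)).unique ?_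
  have := hasSum_single (f := fun j => p j (p i ξ)) i fun j hj =>
    congrArg (fun T : Op H => T ξ) (horth hj)
  convert! this using 1
  exact (congrArg (fun T : Op H => T ξ) (hp i).2.2).symm

/-- Exhaustion: below a projection `e` there is a maximal orthogonal family of projections with a
given property. -/
theorem exists_exhaustion (N : VonNeumannAlgebra H) (e : Op H)
    (P : Op H → Prop) :
    ∃ (S : Set (Op H)) (g : Op H),
      (∀ s : S, IsProjIn (N : Set (Op H)) s.1) ∧ (∀ s : S, e * s.1 = s.1) ∧ (∀ s : S, P s.1) ∧
      (Pairwise fun s t : S => s.1 * t.1 = 0) ∧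
      IsProjIn (N : Set (Op H)) g ∧ e * g = g ∧
      (∀ ξ : H, HasSum (fun s : S => s.1 ξ) (g ξ)) ∧
      ∀ f, IsProjIn (N : Set (Op H)) f → f ≠ 0 → e * f = f → g * f = 0 → ¬ P f := by
  let C : Set (Set (Op H)) := {S | (∀ s ∈ S, IsProjIn (N : Set (Op H)) s ∧ e * s = s ∧ P s) ∧
    S.Pairwise fun s t => s * t = 0}
  obtain ⟨S, hS⟩ := zorn_subset C (by
    intro c hc hchain
    refine ⟨⋃₀ c, ⟨?_, ?_⟩, fun s hs => Set.subset_sUnion_of_mem hs⟩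
    · rintro s ⟨T, hT, hs⟩
      exact (hc hT).1 s hs
    · exact (Set.pairwise_sUnion hchain.directedOn).mpr fun T hT => (hc hT).2)
  have hSC : S ∈ C := hS.prop
  have horth : Pairwise fun s t : S => s.1 * t.1 = 0 := fun s t hst =>
    hSC.2 s.2 t.2 (fun h => hst (Subtype.ext h))
  have hproj : ∀ s : S, IsProjIn (N : Set (Op H)) s.1 := fun s => (hSC.1 s s.2).1
  obtain ⟨g, hg, hsum⟩ := exists_sum_proj hproj horth
  have hgs := mul_eq_self_of_hasSum hproj horth hsum
  refine ⟨S, g, hproj, fun s => (hSC.1 s s.2).2.1, fun s => (hSC.1 s s.2).2.2, horth, hg,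
    mul_eq_of_hasSum hsum fun s => (hSC.1 s s.2).2.1, hsum, ?_⟩
  intro f hf hf0 hef hgf hPf
  have hfg : f * g = 0 := by
    have := congrArg star hgf
    rwa [star_mul, hf.2.1, hg.2.1, star_zero] at this
  have hfs : ∀ s ∈ S, f * s = 0 ∧ s * f = 0 := by
    intro s hs
    have h1 : g * s = s := hgs ⟨s, hs⟩
    have h2 : s * g = s := hg.mul_eq_of_le (hproj ⟨s, hs⟩) h1
    exact ⟨by rw [← h1, ← mul_assoc, hfg, zero_mul], by rw [← h2, mul_assoc, hgf, mul_zero]⟩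
  have hins : insert f S ∈ C := by
    refine ⟨?_, ?_⟩
    · rintro s (rfl | hs)
      · exact ⟨hf, hef, hPf⟩
      · exact hSC.1 s hs
    · exact hSC.2.insert fun s hs _ => hfs s hs
  have hfS : f ∈ S := hS.le_of_ge hins (Set.subset_insert f S) (Set.mem_insert f S)
  exact hf0 (by rw [← hf.2.2]; exact (hfs f hfS).1)

theorem conj_nonneg {a x : Op H} (ha : star a = a) (hx : 0 ≤ x) : 0 ≤ a * x * a := by
  have := star_left_conjugate_nonneg hx a
  rwa [ha] at this

theorem conj_mono {a x y : Op H} (ha : star a = a) (h : x ≤ y) : a * x * a ≤ a * y * a := by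
  have := star_left_conjugate_le_conjugate h a
  rwa [ha] at this

theorem eq_zero_of_mul_self {a : Op H} (h : star a * a = 0) : a = 0 :=
  CStarRing.star_mul_self_eq_zero_iff a |>.mp h

/-- If `0 ≤ x ≤ f` then `2 x = e + y` with `e` a projection and `0 ≤ y ≤ f`. -/
theorem exists_proj_two_smul {N : VonNeumannAlgebra H} {f x : Op H}
    (hf : IsProjIn (N : Set (Op H)) f) (hx : x ∈ N) (hx0 : 0 ≤ x) (hxf : x ≤ f) :
    ∃ e, IsProjIn (N : Set (Op H)) e ∧ f * e = e ∧ 0 ≤ x + x - e ∧ x + x - e ≤ f := by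
  have hxs : star x = x := (IsSelfAdjoint.of_nonneg hx0)
  have hfx : (1 - f) * x = 0 := by
    have h1 : (1 - f) * x * (1 - f) = 0 := by
      refine le_antisymm ?_ (conj_nonneg hf.one_sub.2.1 hx0)
      have := conj_mono hf.one_sub.2.1 hxf
      simpa [sub_mul, mul_sub, hf.2.2] using this
    have hss : CFC.sqrt x * CFC.sqrt x = x := CFC.sqrt_mul_sqrt_self x hx0
    have hs : star (CFC.sqrt x) = CFC.sqrt x :=
      (IsSelfAdjoint.of_nonneg (CFC.sqrt_nonneg x))
    have h2 : CFC.sqrt x * (1 - f) = 0 := by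
      apply eq_zero_of_mul_self
      rw [star_mul, hs, hf.one_sub.2.1, ← h1]
      simp only [mul_assoc]
      rw [← mul_assoc (CFC.sqrt x) (CFC.sqrt x), hss]
    have h3 : x * (1 - f) = 0 := by rw [← hss, mul_assoc, h2, mul_zero]
    have := congrArg star h3
    rwa [star_mul, hf.one_sub.2.1, hxs, star_zero] at this
  set y : Op H := x + x - f with hy
  have hyN : y ∈ N := sub_mem (add_mem hx hx) hf.1
  have hys : IsSelfAdjoint y := by
    simp [IsSelfAdjoint, hy, hxs, hf.2.1]
  have hfy : (1 - f) * y = 0 := by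
    rw [hy, mul_sub, mul_add, hfx, sub_mul, one_mul, hf.2.2]
    simp
  have hps : star (y⁺) = y⁺ := (IsSelfAdjoint.of_nonneg (CFC.posPart_nonneg y))
  have hns : star (y⁻) = y⁻ := (IsSelfAdjoint.of_nonneg (CFC.negPart_nonneg y))
  have hpn := CFC.posPart_sub_negPart y hys
  obtain ⟨e, he, hea, heb⟩ := exists_range_proj (posPart_mem hyN)
  have hne : y⁻ * e = 0 := heb _ (CFC.negPart_mul_posPart y)
  have hen : e * y⁻ = 0 := by
    have := congrArg star hne
    rwa [star_mul, he.2.1, hns, star_zero] at this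
  have hae : y⁺ * e = y⁺ := by
    have := congrArg star hea
    rwa [star_mul, he.2.1, hps] at this
  have hfp : (1 - f) * y⁺ = 0 := by
    have h1 : y * y⁺ = y⁺ * y⁺ := by
      nth_rewrite 1 [← hpn]
      rw [sub_mul, CFC.negPart_mul_posPart, sub_zero]
    have h2 : (1 - f) * y⁺ * y⁺ = 0 := by rw [mul_assoc, ← h1, ← mul_assoc, hfy, zero_mul]
    have h3 : y⁺ * (1 - f) = 0 := by
      apply eq_zero_of_mul_self
      rw [star_mul, hps, hf.one_sub.2.1, ← mul_assoc, h2, zero_mul]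
    have := congrArg star h3
    rwa [star_mul, hf.one_sub.2.1, hps, star_zero] at this
  have hfe : f * e = e := by
    have := heb _ hfp
    rw [sub_mul, one_mul, sub_eq_zero] at this
    exact this.symm
  have hef : e * f = e := hf.mul_eq_of_le he hfe
  have hey : e * y = y⁺ := by rw [← hpn, mul_sub, hea, hen, sub_zero, hpn]
  have hye : y * e = y⁺ := by
    have := congrArg star hey
    rwa [star_mul, he.2.1, hps, hys.star_eq] at this
  have hxx : x + x = y + f := by rw [hy]; abel
  have hx2 : 0 ≤ x + x := add_nonneg hx0 hx0
  refine ⟨e, he, hfe, ?_, ?_⟩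
  · have h1 : x + x - e = y⁺ + (1 - e) * (x + x) * (1 - e) := by
      rw [hxx]
      simp only [sub_mul, mul_sub, mul_add, add_mul, one_mul, mul_one, hey, hye, hae, hfe, hef,
        he.2.2]
      abel
    rw [h1]
    exact add_nonneg (CFC.posPart_nonneg y) (conj_nonneg he.one_sub.2.1 hx2)
  · have h2 : f - (x + x - e) = e * ((f - x) + (f - x)) * e + y⁻ := by
      have h3 : (f - x) + (f - x) = f - y := by rw [hy]; abel
      have h4 : y⁻ = y⁺ - y := by nth_rewrite 3 [← hpn]; abel
      rw [hxx, h3, h4]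
      simp only [sub_mul, mul_sub, hef, hey, hae, he.2.2]
      abel
    rw [← sub_nonneg, h2]
    have h5 : 0 ≤ f - x := sub_nonneg.mpr hxf
    exact add_nonneg (conj_nonneg he.2.1 (add_nonneg h5 h5)) (CFC.negPart_nonneg y)

/-! ### Positive functionals -/

theorem real_smul_mem_vna {N : VonNeumannAlgebra H} (c : ℝ) {x : Op H} (hx : x ∈ N) :
    c • x ∈ N := by
  rw [← Complex.coe_smul]
  exact smul_mem_vna _ hx

theorem sqrt_star (x : Op H) : star (CFC.sqrt x) = CFC.sqrt x :=
  IsSelfAdjoint.of_nonneg (CFC.sqrt_nonneg x)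

theorem mul_self_le_smul_one {k : Op H} (hk : star k = k) : k * k ≤ (‖k‖ ^ 2 + 1) • (1 : Op H) := by
  have h1 : star k * k ≤ algebraMap ℝ (Op H) (‖star k * k‖) :=
    IsSelfAdjoint.le_algebraMap_norm_self (IsSelfAdjoint.star_mul_self k)
  rw [CStarRing.norm_star_mul_self, hk, Algebra.algebraMap_eq_smul_one] at h1
  refine h1.trans ?_
  refine smul_le_smul_of_nonneg_right ?_ zero_le_one
  nlinarith

namespace IsPLF

variable {N : VonNeumannAlgebra H} {ω : Op H → ℂ}

theorem map_zero (hω : IsPLF N ω) : ω 0 = 0 := by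
  simpa using hω.map_smul 0 0 (zero_mem N)

theorem map_sub (hω : IsPLF N ω) {x y : Op H} (hx : x ∈ N) (hy : y ∈ N) :
    ω (x - y) = ω x - ω y := by
  have := hω.map_add (x - y) (sub_mem hx hy) y hy
  rw [sub_add_cancel] at this
  rw [this, add_sub_cancel_right]

theorem map_real_smul (hω : IsPLF N ω) (c : ℝ) {x : Op H} (hx : x ∈ N) :
    ω (c • x) = c * ω x := by
  rw [← Complex.coe_smul, hω.map_smul _ x hx]

theorem nonneg (hω : IsPLF N ω) {x : Op H} (hx : x ∈ N) (h0 : 0 ≤ x) : 0 ≤ ω x := by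
  have := hω.pos _ (sqrt_mem hx)
  rwa [sqrt_star, CFC.sqrt_mul_sqrt_self x h0] at this

theorem re_nonneg (hω : IsPLF N ω) {x : Op H} (hx : x ∈ N) (h0 : 0 ≤ x) : 0 ≤ (ω x).re :=
  (Complex.nonneg_iff.mp (hω.nonneg hx h0)).1

theorem eq_re (hω : IsPLF N ω) {x : Op H} (hx : x ∈ N) (h0 : 0 ≤ x) : ω x = ((ω x).re : ℂ) :=
  Complex.ext rfl (by simpa using (Complex.nonneg_iff.mp (hω.nonneg hx h0)).2.symm)

theorem re_mono (hω : IsPLF N ω) {x y : Op H} (hx : x ∈ N) (hy : y ∈ N) (h : x ≤ y) :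
    (ω x).re ≤ (ω y).re := by
  have := hω.re_nonneg (sub_mem hy hx) (sub_nonneg.mpr h)
  rw [hω.map_sub hy hx, Complex.sub_re] at this
  linarith

theorem map_sum (hω : IsPLF N ω) {ι : Type} (F : Finset ι) {x : ι → Op H} (hx : ∀ i, x i ∈ N) :
    ω (∑ i ∈ F, x i) = ∑ i ∈ F, ω (x i) := by
  classical
  induction F using Finset.induction_on with
  | empty => simpa using hω.map_zero
  | insert i F hi ih =>
    rw [Finset.sum_insert hi, Finset.sum_insert hi,
      hω.map_add _ (hx i) _ (sum_mem fun j _ => hx j), ih]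

end IsPLF

theorem isPLF_vector (N : VonNeumannAlgebra H) (ξ : H) :
    IsPLF N fun x => inner ℂ ξ (x ξ) where
  map_add x _ y _ := by simp
  map_smul c x _ := by simp
  pos x _ := by
    rw [mul_apply_eq_comp, ContinuousLinearMap.star_eq_adjoint,
      ContinuousLinearMap.adjoint_inner_right, inner_self_eq_norm_sq_to_K]
    simp

/-- Domination on projections implies domination on positive elements. -/
theorem IsPLF.re_le_of_proj {N : VonNeumannAlgebra H} {ω τ : Op H → ℂ} (hω : IsPLF N ω)
    (hτ : IsPLF N τ) {f : Op H} (hf : IsProjIn (N : Set (Op H)) f)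
    (h : ∀ e, IsProjIn (N : Set (Op H)) e → f * e = e → (ω e).re ≤ (τ e).re) {x : Op H}
    (hx : x ∈ N) (hx0 : 0 ≤ x) (hxf : x ≤ f) : (ω x).re ≤ (τ x).re := by
  have key : ∀ n : ℕ, ∀ x ∈ N, 0 ≤ x → x ≤ f →
      (ω x).re - (τ x).re ≤ (ω f).re * (1 / 2) ^ n := by
    intro n
    induction n with
    | zero =>
      intro x hx hx0 hxf
      have h1 := hω.re_mono hx hf.1 hxf
      have h2 := hτ.re_nonneg hx hx0
      simp only [pow_zero, mul_one]
      linarith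
    | succ n ih =>
      intro x hx hx0 hxf
      obtain ⟨e, he, hfe, h1, h2⟩ := exists_proj_two_smul hf hx hx0 hxf
      have hxx : x + x ∈ N := add_mem hx hx
      have h3 := ih _ (sub_mem hxx he.1) h1 h2
      rw [hω.map_sub hxx he.1, hτ.map_sub hxx he.1, hω.map_add x hx x hx,
        hτ.map_add x hx x hx] at h3
      simp only [Complex.sub_re, Complex.add_re] at h3
      have h4 := h e he hfe
      rw [pow_succ]
      linarith
  have hlim : Filter.Tendsto (fun n : ℕ => (ω f).re * (1 / 2 : ℝ) ^ n) Filter.atTop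
      (nhds ((ω f).re * 0)) :=
    (tendsto_pow_atTop_nhds_zero_of_lt_one (by norm_num) (by norm_num)).const_mul _
  have := ge_of_tendsto' hlim fun n => key n x hx hx0 hxf
  linarith

/-- Complete additivity of a functional on the projections below `p`. -/
def CompletelyAdditiveBelow (N : VonNeumannAlgebra H) (ω : Op H → ℂ) (p : Op H) : Prop :=
  ∀ (ι : Type) (f : ι → Op H) (g : Op H), (∀ i, IsProjIn (N : Set (Op H)) (f i)) →
    (∀ i, p * f i = f i) → IsProjIn (N : Set (Op H)) g → p * g = g →
    (Pairwise fun i j => f i * f j = 0) → (∀ ξ : H, HasSum (fun i => f i ξ) (g ξ)) →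
    HasSum (fun i => ω (f i)) (ω g)

theorem CompletelyAdditiveBelow.mono {N : VonNeumannAlgebra H} {ω : Op H → ℂ} {p e : Op H}
    (h : CompletelyAdditiveBelow N ω p) (hpe : p * e = e) : CompletelyAdditiveBelow N ω e :=
  fun ι f g hf hef hg heg => h ι f g hf
    (fun i => by rw [← hef i, ← mul_assoc, hpe]) hg (by rw [← heg, ← mul_assoc, hpe])

/-- A completely additive positive functional is dominated by a vector functional on some
nonzero projection. -/
theorem IsPLF.exists_dominated {N : VonNeumannAlgebra H} {ω : Op H → ℂ} (hω : IsPLF N ω)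
    {e : Op H} (he : IsProjIn (N : Set (Op H)) e) (he0 : e ≠ 0)
    (hca : CompletelyAdditiveBelow N ω e) :
    ∃ (f : Op H) (ξ : H), IsProjIn (N : Set (Op H)) f ∧ f ≠ 0 ∧ e * f = f ∧
      ∀ (C : ℝ), 0 < C → ∀ x ∈ N, 0 ≤ x → x ≤ C • f →
        (ω x).re ≤ (inner ℂ ξ (x ξ)).re := by
  obtain ⟨η, hη⟩ : ∃ η, e η ≠ 0 := by
    by_contra! h
    exact he0 (ContinuousLinearMap.ext h)
  have hpos : 0 < ‖e η‖ ^ 2 := by positivity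
  obtain ⟨n, hn⟩ := exists_nat_gt ((ω e).re / ‖e η‖ ^ 2)
  rw [div_lt_iff₀ hpos] at hn
  have hee : e (e η) = e η := congrArg (fun T : Op H => T η) he.2.2
  set ξ : H := (n : ℂ) • e η with hξ
  have hlt : (ω e).re < (inner ℂ ξ (e ξ)).re := by
    have h1 : (inner ℂ ξ (e ξ)).re = (n : ℝ) * n * ‖e η‖ ^ 2 := by
      rw [hξ, _root_.map_smul, hee, inner_self_eq_norm_sq_to_K, norm_smul]
      have h2 : ((‖(n : ℂ)‖ * ‖e η‖ : ℝ) : ℂ) ^ 2 = (((n : ℝ) * n * ‖e η‖ ^ 2 : ℝ) : ℂ) := by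
        rw [Complex.norm_natCast]
        push_cast
        ring
      exact (congrArg Complex.re h2).trans (Complex.ofReal_re _)
    rw [h1]
    refine hn.trans_le (mul_le_mul_of_nonneg_right ?_ hpos.le)
    exact_mod_cast Nat.le_mul_self n
  have hτ := isPLF_vector N ξ
  obtain ⟨S, g, hS, heS, hPS, horth, hg, heg, hsum, hmax⟩ :=
    exists_exhaustion N e fun s => (inner ℂ ξ (s ξ)).re ≤ (ω s).re
  have hge : e - g ≠ 0 := by
    intro h
    have h1 := hca S _ g hS heS hg heg horth hsum
    have h2 : HasSum (fun s : S => inner ℂ ξ (s.1 ξ)) (inner ℂ ξ (g ξ)) :=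
      (hsum ξ).mapL (innerSL ℂ ξ)
    have h3 := hasSum_le hPS (Complex.hasSum_re h2) (Complex.hasSum_re h1)
    rw [← sub_eq_zero.mp h] at h3
    linarith
  have hf := he.sub hg heg
  have hef : e * (e - g) = e - g := by rw [mul_sub, he.2.2, heg]
  refine ⟨e - g, ξ, hf, hge, hef, ?_⟩
  have hproj : ∀ e', IsProjIn (N : Set (Op H)) e' → (e - g) * e' = e' →
      (ω e').re ≤ (inner ℂ ξ (e' ξ)).re := by
    intro e' he' hle
    by_cases h0 : e' = 0
    · simp [h0, hω.map_zero]
    have h1 : e * e' = e' := by rw [← hle, ← mul_assoc, hef]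
    have h2 : g * e' = 0 := by
      rw [← hle, ← mul_assoc, mul_sub, he.mul_eq_of_le hg heg, hg.2.2, sub_self, zero_mul]
    exact le_of_not_ge (hmax e' he' h0 h1 h2)
  intro C hC x hx hx0 hxf
  have hC' : (0 : ℝ) ≤ C⁻¹ := (inv_pos.mpr hC).le
  have h1 := hω.re_le_of_proj hτ hf hproj (real_smul_mem_vna C⁻¹ hx)
    (smul_nonneg hC' hx0) (by
      have := smul_le_smul_of_nonneg_left hxf hC'
      rwa [smul_smul, inv_mul_cancel₀ hC.ne', one_smul] at this)
  rw [hω.map_real_smul _ hx, hτ.map_real_smul _ hx, Complex.re_ofReal_mul,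
    Complex.re_ofReal_mul] at h1
  exact le_of_mul_le_mul_left h1 (inv_pos.mpr hC)

/-- If `ω` is completely additive below `p`, then `ω(k · k)` is normal for `k` supported
under `p`. -/
theorem IsPLF.isNormalPLF_conj {N : VonNeumannAlgebra H} {ω : Op H → ℂ} (hω : IsPLF N ω)
    {p k : Op H} (hp : IsProjIn (N : Set (Op H)) p) (hca : CompletelyAdditiveBelow N ω p)
    (hk : k ∈ N) (hks : star k = k) (hpk : p * k = k) :
    IsNormalPLF N fun x => ω (k * x * k) where
  map_add x hx y hy := by
    rw [mul_add, add_mul]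
    exact hω.map_add _ (mul_mem (mul_mem hk hx) hk) _ (mul_mem (mul_mem hk hy) hk)
  map_smul c x hx := by
    rw [mul_smul_comm, smul_mul_assoc]
    exact hω.map_smul c _ (mul_mem (mul_mem hk hx) hk)
  pos x hx := by
    have := hω.pos (x * k) (mul_mem hx hk)
    rwa [star_mul, hks, ← mul_assoc, mul_assoc k] at this
  normal ι P q hP hq horth hsum := by
    have hkp : k * p = k := by
      have := congrArg star hpk
      rwa [star_mul, hks, hp.2.1] at this
    have hPsum : ∀ F : Finset ι, IsProjIn (N : Set (Op H)) (∑ i ∈ F, P i) := fun F => by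
      classical
      refine ⟨sum_mem fun i _ => (hP i).1, ?_, ?_⟩
      · rw [star_sum]
        exact Finset.sum_congr rfl fun i _ => (hP i).2.1
      · rw [Finset.mul_sum]
        refine Finset.sum_congr rfl fun i hi => ?_
        rw [Finset.sum_mul, Finset.sum_eq_single i (fun j _ hj => horth hj)
          (fun h => absurd hi h), (hP i).2.2]
    have hqP := mul_eq_self_of_hasSum hP horth hsum
    have hr : ∀ F : Finset ι, IsProjIn (N : Set (Op H)) (q - ∑ i ∈ F, P i) := fun F =>
      hq.sub (hPsum F) (by rw [Finset.mul_sum]; exact Finset.sum_congr rfl fun i _ => hqP i)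
    set r : Finset ι → Op H := fun F => q - ∑ i ∈ F, P i with hrdef
    have hr0 : ∀ ξ, Filter.Tendsto (fun F => r F ξ) Filter.atTop (nhds 0) := by
      intro ξ
      have h1 : Filter.Tendsto (fun F : Finset ι => q ξ - ∑ i ∈ F, P i ξ) Filter.atTop
          (nhds (q ξ - q ξ)) := tendsto_const_nhds.sub (hsum ξ)
      rw [sub_self] at h1
      simpa [hrdef] using h1
    set C : ℝ := ‖k‖ ^ 2 + 1 with hC
    have hC0 : 0 < C := by positivity
    let X : Finset ι → Op H := fun F => k * r F * k
    have hXN : ∀ F, X F ∈ N := fun F => mul_mem (mul_mem hk (hr F).1) hk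
    have hX0 : ∀ F, 0 ≤ X F := fun F => conj_nonneg hks (hr F).nonneg
    have hXC : ∀ F, X F ≤ C • (1 : Op H) := fun F =>
      (conj_mono hks (hr F).le_one).trans (by rw [mul_one]; exact mul_self_le_smul_one hks)
    have hbX : ∀ b, IsProjIn (N : Set (Op H)) b → ∀ F, b * X F * b ≤ C • b := by
      intro b hb F
      have := conj_mono hb.2.1 (hXC F)
      rwa [mul_smul_comm, smul_mul_assoc, mul_one, hb.2.2] at this
    have hmem : ∀ a ∈ N, ∀ F, a * X F * a ∈ N := fun a ha F => mul_mem (mul_mem ha (hXN F)) ha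
    have hadd : ∀ a ∈ N, ∀ b ∈ N, star a = a → star b = b → ∀ F,
        (ω ((a + b) * X F * (a + b))).re ≤
          2 * (ω (a * X F * a)).re + 2 * (ω (b * X F * b)).re := by
      intro a ha b hb hsa hsb F
      have h1 : 0 ≤ (a - b) * X F * (a - b) := conj_nonneg (by rw [star_sub, hsa, hsb]) (hX0 F)
      have h2 : (a - b) * X F * (a - b) = (a * X F * a + a * X F * a) +
          (b * X F * b + b * X F * b) - (a + b) * X F * (a + b) := by
        simp only [sub_mul, mul_sub, add_mul, mul_add]
        abel
      rw [h2, sub_nonneg] at h1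
      have hA := hmem a ha F
      have hB := hmem b hb F
      have h3 := hω.re_mono (hmem _ (add_mem ha hb) F)
        (add_mem (add_mem hA hA) (add_mem hB hB)) h1
      rw [hω.map_add _ (add_mem hA hA) _ (add_mem hB hB), hω.map_add _ hA _ hA,
        hω.map_add _ hB _ hB] at h3
      simp only [Complex.add_re] at h3
      linarith
    let Good : Op H → Prop := fun f =>
      Filter.Tendsto (fun F => (ω (f * X F * f)).re) Filter.atTop (nhds 0)
    have hgood : ∀ e, IsProjIn (N : Set (Op H)) e → e ≠ 0 → p * e = e →
        ∃ f, IsProjIn (N : Set (Op H)) f ∧ f ≠ 0 ∧ e * f = f ∧ Good f := by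
      intro e he he0 hpe
      obtain ⟨f, ξ, hf, hf0, hef, hdom⟩ := hω.exists_dominated he he0 (hca.mono hpe)
      refine ⟨f, hf, hf0, hef, ?_⟩
      have hlim : Filter.Tendsto (fun F => (inner ℂ ξ (f (k (r F (k (f ξ)))))).re) Filter.atTop
          (nhds 0) := by
        have h1 := (((innerSL ℂ ξ).comp (f * k)).continuous.tendsto 0).comp (hr0 (k (f ξ)))
        have h2 := (Complex.continuous_re.tendsto _).comp h1
        simpa [Function.comp_def] using h2
      refine squeeze_zero (fun F => hω.re_nonneg (hmem f hf.1 F) (conj_nonneg hf.2.1 (hX0 F)))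
        (fun F => ?_) hlim
      exact hdom C hC0 _ (hmem f hf.1 F) (conj_nonneg hf.2.1 (hX0 F)) (hbX f hf F)
    obtain ⟨S, g, hS, hpS, hGS, hSorth, hg, hpg, hSsum, hmax⟩ := exists_exhaustion N p Good
    have hgp : p - g = 0 := by
      by_contra h0
      have hpp : p * (p - g) = p - g := by rw [mul_sub, hp.2.2, hpg]
      obtain ⟨f, hf, hf0, hef, hGf⟩ := hgood (p - g) (hp.sub hg hpg) h0 hpp
      refine hmax f hf hf0 ?_ ?_ hGf
      · rw [← hef, ← mul_assoc, hpp]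
      · rw [← hef, ← mul_assoc, mul_sub, hp.mul_eq_of_le hg hpg, hg.2.2, sub_self, zero_mul]
    have hωS := hca S _ g hS hpS hg hpg hSorth hSsum
    rw [← sub_eq_zero.mp hgp] at hωS
    have hJproj : ∀ J : Finset S, IsProjIn (N : Set (Op H)) (∑ s ∈ J, s.1) := fun J => by
      classical
      refine ⟨sum_mem fun i _ => (hS i).1, ?_, ?_⟩
      · rw [star_sum]
        exact Finset.sum_congr rfl fun i _ => (hS i).2.1
      · rw [Finset.mul_sum]
        refine Finset.sum_congr rfl fun i hi => ?_
        rw [Finset.sum_mul, Finset.sum_eq_single i (fun j _ hj => hSorth hj)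
          (fun h => absurd hi h), (hS i).2.2]
    have hJgood : ∀ J : Finset S, Good (∑ s ∈ J, s.1) := by
      classical
      intro J
      induction J using Finset.induction_on with
      | empty => simp [Good, hω.map_zero]
      | insert s J hs ih =>
        rw [Finset.sum_insert hs]
        have hj := (hJproj J)
        have h1 : Filter.Tendsto (fun F => 2 * (ω (s.1 * X F * s.1)).re +
            2 * (ω ((∑ s ∈ J, s.1) * X F * (∑ s ∈ J, s.1))).re) Filter.atTop (nhds 0) := by
          have h2 := ((hGS s).const_mul 2).add (ih.const_mul 2)
          simpa using h2
        refine squeeze_zero (fun F => ?_)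
          (fun F => hadd s.1 (hS s).1 _ hj.1 (hS s).2.1 hj.2.1 F) h1
        exact hω.re_nonneg (hmem _ (add_mem (hS s).1 hj.1) F)
          (conj_nonneg (by rw [star_add, (hS s).2.1, hj.2.1]) (hX0 F))
    have hXlim : Filter.Tendsto (fun F => (ω (X F)).re) Filter.atTop (nhds 0) := by
      rw [Metric.tendsto_nhds]
      intro ε hε
      have h1 : Filter.Tendsto (fun J : Finset S => 2 * (C * (ω (p - ∑ s ∈ J, s.1)).re))
          Filter.atTop (nhds 0) := by
        have h2 : Filter.Tendsto (fun J : Finset S => ω p - ∑ s ∈ J, ω s.1) Filter.atTop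
            (nhds (ω p - ω p)) := tendsto_const_nhds.sub hωS
        have h3 := (((Complex.continuous_re.tendsto _).comp h2).const_mul C).const_mul 2
        simp only [sub_self, Complex.zero_re, mul_zero] at h3
        refine h3.congr fun J => ?_
        simp only [Function.comp_apply]
        rw [hω.map_sub hp.1 (hJproj J).1, hω.map_sum J fun s => (hS s).1]
      obtain ⟨J, hJ⟩ := (h1.eventually (gt_mem_nhds (half_pos hε))).exists
      have hJ2 := (hJgood J).const_mul 2
      rw [mul_zero] at hJ2
      filter_upwards [hJ2.eventually (gt_mem_nhds (half_pos hε))] with F hF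
      rw [Real.dist_eq, sub_zero, abs_of_nonneg (hω.re_nonneg (hXN F) (hX0 F))]
      have hpJ : p * ∑ s ∈ J, s.1 = ∑ s ∈ J, s.1 := by
        rw [Finset.mul_sum]
        exact Finset.sum_congr rfl fun s _ => hpS s
      have hb := hp.sub (hJproj J) hpJ
      have h4 := hadd _ (hJproj J).1 _ hb.1 (hJproj J).2.1 hb.2.1 F
      have h5 : (∑ s ∈ J, s.1) + (p - ∑ s ∈ J, s.1) = p := by abel
      have h6 : p * X F * p = X F := by
        simp only [X]
        rw [← mul_assoc, ← mul_assoc, hpk, mul_assoc _ k p, hkp]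
      rw [h5, h6] at h4
      have h7 := hω.re_mono (hmem _ hb.1 F) (real_smul_mem_vna C hb.1) (hbX _ hb F)
      rw [hω.map_real_smul C hb.1, Complex.re_ofReal_mul] at h7
      linarith
    have hXlim' : Filter.Tendsto (fun F => ω (X F)) Filter.atTop (nhds 0) := by
      have h1 := (Complex.continuous_ofReal.tendsto _).comp hXlim
      rw [Complex.ofReal_zero] at h1
      exact h1.congr fun F => (hω.eq_re (hXN F) (hX0 F)).symm
    have hkPk : ∀ i, k * P i * k ∈ N := fun i => mul_mem (mul_mem hk (hP i).1) hk
    have hkqk : k * q * k ∈ N := mul_mem (mul_mem hk hq.1) hk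
    have hfin : ∀ F : Finset ι, ω (k * q * k) - ω (X F) = ∑ i ∈ F, ω (k * P i * k) := by
      intro F
      rw [← hω.map_sum F hkPk, ← hω.map_sub hkqk (hXN F)]
      congr 1
      simp only [X, hrdef]
      rw [mul_sub, sub_mul, Finset.mul_sum, Finset.sum_mul]
      abel
    have h8 := (tendsto_const_nhds (x := ω (k * q * k))).sub hXlim'
    rw [sub_zero] at h8
    exact h8.congr hfin

/-! ### Weights -/

namespace IsFNSWeight

variable {N : VonNeumannAlgebra H} {ψ : WeightData H}

theorem val_mono (hψ : IsFNSWeight N ψ) {x y : Op H} (hx : x ∈ N) (hy : y ∈ N) (h0 : 0 ≤ x)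
    (h : x ≤ y) : ψ.val x ≤ ψ.val y := by
  have := hψ.map_add x hx (y - x) (sub_mem hy hx) (isPos_iff.mpr h0)
    (isPos_iff.mpr (sub_nonneg.mpr h))
  rw [add_sub_cancel] at this
  rw [this]
  exact le_self_add

theorem val_smul_ne_top (hψ : IsFNSWeight N ψ) {x : Op H} (hx : x ∈ N) (h0 : 0 ≤ x)
    (hfin : ψ.val x ≠ ⊤) (c : ℝ) (hc : 0 < c) : ψ.val (c • x) ≠ ⊤ := by
  rw [← Complex.coe_smul, hψ.map_smul c hc x hx (isPos_iff.mpr h0)]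
  exact ENNReal.mul_ne_top ENNReal.ofReal_ne_top hfin

theorem val_add_ne_top (hψ : IsFNSWeight N ψ) {x y : Op H} (hx : x ∈ N) (hy : y ∈ N)
    (hx0 : 0 ≤ x) (hy0 : 0 ≤ y) (hxf : ψ.val x ≠ ⊤) (hyf : ψ.val y ≠ ⊤) :
    ψ.val (x + y) ≠ ⊤ := by
  rw [hψ.map_add x hx y hy (isPos_iff.mpr hx0) (isPos_iff.mpr hy0)]
  exact ENNReal.add_ne_top.mpr ⟨hxf, hyf⟩

theorem val_ne_top_of_le (hψ : IsFNSWeight N ψ) {x y : Op H} (hx : x ∈ N) (hy : y ∈ N)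
    (h0 : 0 ≤ x) (h : x ≤ y) (hfin : ψ.val y ≠ ⊤) : ψ.val x ≠ ⊤ :=
  ne_top_of_le_ne_top hfin (hψ.val_mono hx hy h0 h)

theorem cval_eq (hψ : IsFNSWeight N ψ) {x : Op H} (hx : x ∈ N) (h0 : 0 ≤ x)
    (hfin : ψ.val x ≠ ⊤) : ψ.cval x = ((ψ.val x).toReal : ℂ) :=
  hψ.cval_compat x hx (isPos_iff.mpr h0) hfin

/-- Compressing a weight by a projection of finite weight gives a positive functional. -/
theorem isPLF_compress (hψ : IsFNSWeight N ψ) {p : Op H} (hp : IsProjIn (N : Set (Op H)) p)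
    (hfin : ψ.val p ≠ ⊤) : IsPLF N fun x => ψ.cval (p * x * p) where
  map_add x hx y hy := by
    rw [mul_add, add_mul]
    exact hψ.cval_add _ (mul_mem (mul_mem hp.1 hx) hp.1) _ (mul_mem (mul_mem hp.1 hy) hp.1)
  map_smul c x hx := by
    rw [mul_smul_comm, smul_mul_assoc]
    exact hψ.cval_smul c _ (mul_mem (mul_mem hp.1 hx) hp.1)
  pos x hx := by
    have hxx : star x * x ∈ N := mul_mem (star_mem hx) hx
    have h0 : 0 ≤ p * (star x * x) * p := conj_nonneg hp.2.1 (star_mul_self_nonneg x)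
    have h1 : p * (star x * x) * p ≤ (‖star x * x‖ + 1) • p := by
      have h2 : star x * x ≤ (‖star x * x‖ + 1) • (1 : Op H) := by
        have h3 := IsSelfAdjoint.le_algebraMap_norm_self (IsSelfAdjoint.star_mul_self x)
        rw [Algebra.algebraMap_eq_smul_one] at h3
        exact h3.trans (smul_le_smul_of_nonneg_right (by linarith) zero_le_one)
      have := conj_mono hp.2.1 h2
      rwa [mul_smul_comm, smul_mul_assoc, mul_one, hp.2.2] at this
    have hm : p * (star x * x) * p ∈ N := mul_mem (mul_mem hp.1 hxx) hp.1
    rw [hψ.cval_eq hm h0 (hψ.val_ne_top_of_le hm (real_smul_mem_vna _ hp.1) h0 h1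
      (hψ.val_smul_ne_top hp.1 hp.nonneg hfin _ (by positivity)))]
    exact Complex.zero_le_real.mpr ENNReal.toReal_nonneg

theorem completelyAdditiveBelow (hψ : IsFNSWeight N ψ) {p : Op H}
    (hp : IsProjIn (N : Set (Op H)) p) (hfin : ψ.val p ≠ ⊤) :
    CompletelyAdditiveBelow N (fun x => ψ.cval (p * x * p)) p := by
  intro ι f g hf hpf hg hpg horth hsum
  have key : ∀ e, IsProjIn (N : Set (Op H)) e → p * e = e → ψ.val e ≠ ⊤ ∧
      ψ.cval (p * e * p) = ((ψ.val e).toReal : ℂ) := by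
    intro e he hpe
    have h1 : ψ.val e ≠ ⊤ := hψ.val_ne_top_of_le he.1 hp.1 he.nonneg
      (sub_nonneg.mp (hp.sub he hpe).nonneg) hfin
    exact ⟨h1, by rw [hpe, hp.mul_eq_of_le he hpe, hψ.cval_eq he.1 he.nonneg h1]⟩
  have h1 := hψ.normal ι f g hf hg horth hsum
  have h2 : ∑' i, ψ.val (f i) ≠ ⊤ := h1 ▸ (key g hg hpg).1
  have h3 := ENNReal.hasSum_toReal h2
  rw [← ENNReal.tsum_toReal_eq (fun i => (key _ (hf i) (hpf i)).1), ← h1] at h3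
  have h4 := Complex.hasSum_ofReal.mpr h3
  simp only [(key g hg hpg).2, fun i => (key _ (hf i) (hpf i)).2]
  exact h4

/-- The functional `ψ(k · k)` is normal when `k` is supported under a projection of finite
weight. -/
theorem isNormalPLF_conj (hψ : IsFNSWeight N ψ) {p k : Op H}
    (hp : IsProjIn (N : Set (Op H)) p) (hfin : ψ.val p ≠ ⊤) (hk : k ∈ N) (hks : star k = k)
    (hpk : p * k = k) : IsNormalPLF N fun x => ψ.cval (k * x * k) := by
  have hkp : k * p = k := by
    have := congrArg star hpk
    rwa [star_mul, hks, hp.2.1] at this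
  have := (hψ.isPLF_compress hp hfin).isNormalPLF_conj hp (hψ.completelyAdditiveBelow hp hfin)
    hk hks hpk
  have heq : (fun x => ψ.cval (p * (k * x * k) * p)) = fun x => ψ.cval (k * x * k) := by
    funext x
    rw [← mul_assoc, ← mul_assoc, hpk, mul_assoc _ k p, hkp]
  rwa [heq] at this

end IsFNSWeight

/-! ### Conditional expectations and centralizers -/

namespace IsCondExp

variable {M N : VonNeumannAlgebra H} {E : Op H → Op H}

theorem map_sub (hE : IsCondExp M N E) {x y : Op H} (hx : x ∈ M) (hy : y ∈ M) :
    E (x - y) = E x - E y := by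
  have := hE.map_add' (x - y) (sub_mem hx hy) y hy
  rw [sub_add_cancel] at this
  rw [this, add_sub_cancel_right]

theorem mul_left (hE : IsCondExp M N E) {a x : Op H} (ha : a ∈ N) (hx : x ∈ M) :
    E (a * x) = a * E x := by
  simpa using hE.bimod' a ha x hx 1 (one_mem N)

theorem mul_right (hE : IsCondExp M N E) {x b : Op H} (hx : x ∈ M) (hb : b ∈ N) :
    E (x * b) = E x * b := by
  simpa using hE.bimod' 1 (one_mem N) x hx b hb

theorem nonneg (hE : IsCondExp M N E) {x : Op H} (hx : x ∈ M) (h0 : 0 ≤ x) : 0 ≤ E x :=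
  isPos_iff.mp (hE.pos' x hx (isPos_iff.mpr h0))

theorem mono (hE : IsCondExp M N E) {x y : Op H} (hx : x ∈ M) (hy : y ∈ M) (h : x ≤ y) :
    E x ≤ E y := by
  have := hE.nonneg (sub_mem hy hx) (sub_nonneg.mpr h)
  rwa [hE.map_sub hy hx, sub_nonneg] at this

/-- The Kadison–Schwarz inequality for a conditional expectation. -/
theorem star_mul_le (hE : IsCondExp M N E) {y : Op H} (hy : y ∈ M) :
    star (E y) * E y ≤ E (star y * y) := by
  have hEy := hE.mem' y hy
  have hEyM : E y ∈ M := hE.subset' hEy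
  have hsy := star_mem hy
  have hsE := star_mem hEy
  have hsEM := star_mem hEyM
  have h1 : star (y - E y) * (y - E y) =
      (star y * y - star y * E y) - (star (E y) * y - star (E y) * E y) := by
    rw [star_sub]
    simp only [sub_mul, mul_sub]
    abel
  have h2 := hE.nonneg (mul_mem (star_mem (sub_mem hy hEyM)) (sub_mem hy hEyM))
    (star_mul_self_nonneg (y - E y))
  rw [h1, hE.map_sub (sub_mem (mul_mem hsy hy) (mul_mem hsy hEyM))
    (sub_mem (mul_mem hsEM hy) (mul_mem hsEM hEyM)),
    hE.map_sub (mul_mem hsy hy) (mul_mem hsy hEyM),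
    hE.map_sub (mul_mem hsEM hy) (mul_mem hsEM hEyM), hE.mul_right hsy hEy, hE.map_star' y hy,
    hE.mul_left hsE hy, hE.fix' _ (mul_mem hsE hEy), sub_self, sub_zero, sub_nonneg] at h2
  exact h2

end IsCondExp

theorem cval_sub {N : VonNeumannAlgebra H} {ψ : WeightData H} (hψ : IsFNSWeight N ψ) {x y : Op H}
    (hx : x ∈ N) (hy : y ∈ N) : ψ.cval (x - y) = ψ.cval x - ψ.cval y := by
  have := hψ.cval_add (x - y) (sub_mem hx hy) y hy
  rw [sub_add_cancel] at this
  rw [this, add_sub_cancel_right]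

/-- A self-adjoint element of finite weight fixed by the modular flow is central for the
weight. -/
theorem IsModularFlowW.cval_comm {N : VonNeumannAlgebra H} {ψ : WeightData H}
    {σ : ℝ → Op H → Op H} (hσ : IsModularFlowW N ψ σ) {x y : Op H} (hx : x ∈ flowFixed N σ)
    (hxs : star x = x) (hfin : ψ.val (x * x) ≠ ⊤) (hy : y ∈ N) (hy1 : ψ.val (star y * y) ≠ ⊤)
    (hy2 : ψ.val (y * star y) ≠ ⊤) : ψ.cval (x * y) = ψ.cval (y * x) := by
  obtain ⟨F, hc, hd, hb, h0, h1⟩ := hσ.kms' x hx.1 y hy (by rwa [hxs]) (by rwa [hxs]) hy1 hy2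
  have h2 := strip_eq_of_const hc hd hb (c := ψ.cval (x * y)) fun t => by rw [h0 t, hx.2 t]
  have h3 := h1 0
  rw [Complex.ofReal_zero, zero_add, h2, hx.2 0] at h3
  exact h3

/-- Self-adjoint elements of finite weight in the centralizer of `ψ` lie in the centralizer of
`ψ ∘ E`. -/
theorem mem_flowFixed_of_condExp {M N : VonNeumannAlgebra H} {E : Op H → Op H}
    (hE : IsCondExp M N E) {ψ : WeightData H} (hψ : IsFNSWeight N ψ) {σN σM : ℝ → Op H → Op H}
    (hσN : IsModularFlowW N ψ σN)
    (hσM : IsModularFlowW M ⟨fun x => ψ.val (E x), fun x => ψ.cval (E x)⟩ σM) {x : Op H}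
    (hx : x ∈ flowFixed N σN) (hxs : star x = x) (hfin : ψ.val (x * x) ≠ ⊤) :
    x ∈ flowFixed M σM := by
  have hxM : x ∈ M := hE.subset' hx.1
  have hxx : x * x ∈ N := mul_mem hx.1 hx.1
  have hxxM : x * x ∈ M := hE.subset' hxx
  have hxx0 : 0 ≤ x * x := by
    have := star_mul_self_nonneg x
    rwa [hxs] at this
  have hExx : E (x * x) = x * x := hE.fix' _ hxx
  have hys : ∀ t, star (σM t x) = σM t x := fun t => by rw [← hσM.map_star' t x hxM, hxs]
  have hyM : ∀ t, σM t x ∈ M := fun t => hσM.mem' t x hxM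
  have hval : ∀ t, ψ.val (E (σM t x * σM t x)) = ψ.val (x * x) := fun t => by
    rw [← hσM.map_mul' t x hxM x hxM]
    exact (hσM.invariant' t _ hxxM (isPos_iff.mpr hxx0)).trans (congrArg ψ.val hExx)
  have hyy0 : ∀ t, 0 ≤ σM t x * σM t x := fun t => by
    have := star_mul_self_nonneg (σM t x)
    rwa [hys t] at this
  have hcomm : ∀ t, ψ.cval (E (x * σM t x)) = ψ.cval (E (σM t x * x)) := by
    intro t
    have hEs : star (E (σM t x)) = E (σM t x) := by rw [← hE.map_star' _ (hyM t), hys t]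
    have h1 := hE.star_mul_le (hyM t)
    rw [hys t, hEs] at h1
    have hEN := hE.mem' _ (hyM t)
    have h2 : ψ.val (E (σM t x) * E (σM t x)) ≠ ⊤ := by
      refine hψ.val_ne_top_of_le (mul_mem hEN hEN) (hE.mem' _ (mul_mem (hyM t) (hyM t))) ?_ h1
        (by rwa [hval t])
      have := star_mul_self_nonneg (E (σM t x))
      rwa [hEs] at this
    rw [hE.mul_left hx.1 (hyM t), hE.mul_right (hyM t) hx.1]
    exact hσN.cval_comm hx hxs hfin hEN (by rwa [hEs]) (by rwa [hEs])
  have hfinM : ψ.val (E (x * x)) ≠ ⊤ := by rwa [hExx]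
  have hconst : ∀ t, ψ.cval (E (σM t x * x)) = ψ.cval (x * x) := by
    intro t
    obtain ⟨F, hc, hd, hb, h0, h1⟩ := hσM.kms' x hxM x hxM (by rwa [hxs]) (by rwa [hxs])
      (by rwa [hxs]) (by rwa [hxs])
    have h2 := strip_const_of_periodic hc hd hb
      (fun t => (h1 t).trans ((hcomm t).trans (h0 t).symm)) t 0
    rw [h0 t, h0 0, hσM.zero' x hxM] at h2
    exact h2.trans (congrArg ψ.cval hExx)
  refine ⟨hxM, fun t => ?_⟩
  set y := σM t x with hy
  have hyyM : y * y ∈ M := mul_mem (hyM t) (hyM t)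
  have hyxM : y * x ∈ M := mul_mem (hyM t) hxM
  have hxyM : x * y ∈ M := mul_mem hxM (hyM t)
  have hd : star (y - x) * (y - x) = (y * y - y * x) - (x * y - x * x) := by
    rw [star_sub, hys t, hxs]
    simp only [sub_mul, mul_sub, ← hy]
    abel
  have hdM : star (y - x) * (y - x) ∈ M := by
    rw [hd]
    exact sub_mem (sub_mem hyyM hyxM) (sub_mem hxyM hxxM)
  have hdd0 := star_mul_self_nonneg (y - x)
  have hEd0 := hE.nonneg hdM hdd0
  have hle : star (y - x) * (y - x) ≤ (y * y + y * y) + (x * x + x * x) := by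
    have h1 := star_mul_self_nonneg (y + x)
    have h2 : (y * y + y * y) + (x * x + x * x) - star (y - x) * (y - x) =
        star (y + x) * (y + x) := by
      rw [hd, star_add, hys t, hxs]
      simp only [add_mul, mul_add, ← hy]
      abel
    rw [← sub_nonneg, h2]
    exact h1
  have hEyy := hE.mem' _ hyyM
  have hEyy0 := hE.nonneg hyyM (hyy0 t)
  have hyfin : ψ.val (E (y * y)) ≠ ⊤ := by rwa [hval t]
  have hdfin : ψ.val (E (star (y - x) * (y - x))) ≠ ⊤ := by
    have h1 := hE.mono hdM (add_mem (add_mem hyyM hyyM) (add_mem hxxM hxxM)) hle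
    rw [hE.map_add' _ (add_mem hyyM hyyM) _ (add_mem hxxM hxxM), hE.map_add' _ hyyM _ hyyM,
      hE.map_add' _ hxxM _ hxxM, hExx] at h1
    refine hψ.val_ne_top_of_le (hE.mem' _ hdM)
      (add_mem (add_mem hEyy hEyy) (add_mem hxx hxx)) hEd0 h1 ?_
    exact hψ.val_add_ne_top (add_mem hEyy hEyy) (add_mem hxx hxx) (add_nonneg hEyy0 hEyy0)
      (add_nonneg hxx0 hxx0) (hψ.val_add_ne_top hEyy hEyy hEyy0 hEyy0 hyfin hyfin)
      (hψ.val_add_ne_top hxx hxx hxx0 hxx0 hfin hfin)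
  have hc0 : ψ.cval (E (star (y - x) * (y - x))) = 0 := by
    rw [hd, hE.map_sub (sub_mem hyyM hyxM) (sub_mem hxyM hxxM), hE.map_sub hyyM hyxM,
      hE.map_sub hxyM hxxM, cval_sub hψ (sub_mem hEyy (hE.mem' _ hyxM))
      (sub_mem (hE.mem' _ hxyM) (hE.mem' _ hxxM)), cval_sub hψ hEyy (hE.mem' _ hyxM),
      cval_sub hψ (hE.mem' _ hxyM) (hE.mem' _ hxxM), hcomm t, hconst t, hExx,
      hψ.cval_eq hEyy hEyy0 hyfin, hval t, hψ.cval_eq hxx hxx0 hfin]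
    ring
  rw [hψ.cval_eq (hE.mem' _ hdM) hEd0 hdfin, Complex.ofReal_eq_zero,
    ENNReal.toReal_eq_zero_iff] at hc0
  have h1 := hψ.faithful _ (hE.mem' _ hdM) (isPos_iff.mpr hEd0) (hc0.resolve_right hdfin)
  exact sub_eq_zero.mp (eq_zero_of_mul_self
    (hE.faithful' _ hdM (isPos_iff.mpr hdd0) h1))

/-! ### Intertwining relations -/

theorem Intertwined.congr {M : VonNeumannAlgebra H} {ψ φ ψ' φ' : Op H → ℂ}
    (h : Intertwined M ψ φ) (hψ : ∀ x ∈ M, ψ x = ψ' x) (hφ : ∀ x ∈ M, φ x = φ' x) :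
    Intertwined M ψ' φ' := by
  have hsupp : ∀ {α β : Op H → ℂ} {q : Op H}, (∀ x ∈ M, α x = β x) → IsSupportProjOf M α q →
      IsSupportProjOf M β q := by
    rintro α β q hαβ ⟨hq, h1, h2⟩
    have hmem : ∀ r, IsProjIn (M : Set (Op H)) r → ∀ x ∈ M, r * x * r ∈ M := fun r hr x hx =>
      mul_mem (mul_mem hr.1 hx) hr.1
    refine ⟨hq, fun x hx => ?_, fun r hr hrx => h2 r hr fun x hx => ?_⟩
    · rw [← hαβ _ (hmem q hq x hx), ← hαβ x hx, h1 x hx]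
    · rw [hαβ _ (hmem r hr x hx), hαβ x hx, hrx x hx]
  obtain ⟨v, q, p, l, hl, hv, hvi, hv0, hq, hp, hqv, hvp, hrel⟩ := h
  refine ⟨v, q, p, l, hl, hv, hvi, hv0, hsupp hψ hq, hsupp hφ hp, hqv, hvp, fun x hx => ?_⟩
  rw [← hψ _ (mul_mem hv hx), ← hφ _ (mul_mem hx hv), hrel x hx]

/-- Intertwining is invariant under unitary conjugation of the first functional. -/
theorem Intertwined.conj_unitary {M : VonNeumannAlgebra H} {ψ φ : Op H → ℂ}
    (h : Intertwined M ψ φ) {w : Op H} (hw : IsUnitaryIn (M : Set (Op H)) w) :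
    Intertwined M (fun x => ψ (w * x * star w)) φ := by
  obtain ⟨v, q, p, l, hl, hv, hvi, hv0, ⟨hq, hq1, hq2⟩, hp, hqv, hvp, hrel⟩ := h
  obtain ⟨hwM, hw1, hw2⟩ := hw
  have hwM' : w ∈ M := hwM
  have hsM : star w ∈ M := star_mem hwM
  have e1 : ∀ y, star w * (w * y) = y := fun y => by rw [← mul_assoc, hw1, one_mul]
  have e2 : ∀ y, w * (star w * y) = y := fun y => by rw [← mul_assoc, hw2, one_mul]
  have e3 : ∀ y, q * (q * y) = q * y := fun y => by rw [← mul_assoc, hq.2.2]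
  refine ⟨star w * v, star w * q * w, p, l, hl, mul_mem hsM hv, ?_, ?_, ⟨⟨?_, ?_, ?_⟩, ?_, ?_⟩,
    hp, ?_, ?_, ?_⟩
  · simp only [IsPartialIsom, star_mul, star_star, mul_assoc, e2] at hvi ⊢
    exact hvi
  · intro h0
    have := congrArg (w * ·) h0
    simp only [e2, mul_zero] at this
    exact hv0 this
  · exact mul_mem (mul_mem hsM hq.1) hwM'
  · simp only [star_mul, star_star, hq.2.1, mul_assoc]
  · simp only [mul_assoc, e2, e3]
  · intro x hx
    have := hq1 (w * x * star w) (mul_mem (mul_mem hwM' hx) hsM)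
    simp only [mul_assoc, e2, hw2, mul_one] at this ⊢
    exact this
  · intro r hr hrx
    have hr' : IsProjIn (M : Set (Op H)) (w * r * star w) := by
      refine ⟨mul_mem (mul_mem hwM' hr.1) hsM, ?_, ?_⟩
      · simp only [star_mul, star_star, hr.2.1, mul_assoc]
      · simp only [mul_assoc, e1]
        rw [← mul_assoc r r, hr.2.2]
    have h1 := hq2 _ hr' fun x hx => by
      have := hrx (star w * x * w) (mul_mem (mul_mem hsM hx) hwM')
      simp only [mul_assoc, e2, hw2, mul_one] at this ⊢
      exact this
    have h2 := congrArg (fun y => star w * y * w) h1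
    simp only [mul_assoc, hw1, mul_one] at h2 ⊢
    exact h2
  · simp only [mul_assoc, e2, hqv]
  · rw [mul_assoc, hvp]
  · intro x hx
    have := hrel (x * star w) (mul_mem hx hsM)
    simp only [mul_assoc, e2] at this ⊢
    exact this

/-- The automorphism `Ad(u*) ∘ Θ`. -/
noncomputable def VNAut.conjUnitary {M : VonNeumannAlgebra H} (Θ : VNAut M) (u : Op H)
    (hu : IsUnitaryIn (M : Set (Op H)) u) : VNAut M where
  toFun x := star u * Θ.toFun x * u
  invFun x := Θ.invFun (u * x * star u)
  mem' x hx := mul_mem (mul_mem (star_mem hu.1) (Θ.mem' x hx)) hu.1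
  inv_mem' x hx := Θ.inv_mem' _ (mul_mem (mul_mem hu.1 hx) (star_mem hu.1))
  left_inv' x hx := by
    have h1 : u * (star u * Θ.toFun x * u) * star u = Θ.toFun x := by
      simp only [mul_assoc, hu.2.2, mul_one]
      rw [← mul_assoc, hu.2.2, one_mul]
    rw [h1, Θ.left_inv' x hx]
  right_inv' x hx := by
    rw [Θ.right_inv' _ (mul_mem (mul_mem hu.1 hx) (star_mem hu.1))]
    simp only [mul_assoc, hu.2.1, mul_one]
    rw [← mul_assoc, hu.2.1, one_mul]
  map_add' x hx y hy := by rw [Θ.map_add' x hx y hy, mul_add, add_mul]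
  map_smul' c x hx := by rw [Θ.map_smul' c x hx, mul_smul_comm, smul_mul_assoc]
  map_mul' x hx y hy := by
    have e : ∀ z, u * (star u * z) = z := fun z => by rw [← mul_assoc, hu.2.2, one_mul]
    simp only [Θ.map_mul' x hx y hy, mul_assoc, e]
  map_star' x hx := by simp only [Θ.map_star' x hx, star_mul, star_star, mul_assoc]

/-- An element supported under a projection of finite weight is square integrable. -/
theorem IsFNSWeight.val_mul_self_ne_top {N : VonNeumannAlgebra H} {ψ : WeightData H}
    (hψ : IsFNSWeight N ψ) {p a : Op H} (hp : IsProjIn (N : Set (Op H)) p) (hfin : ψ.val p ≠ ⊤)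
    (ha : a ∈ N) (has : star a = a) (hpa : p * a = a) : ψ.val (a * a) ≠ ⊤ := by
  have hap : a * p = a := by
    have := congrArg star hpa
    rwa [star_mul, has, hp.2.1] at this
  have h0 : 0 ≤ a * a := by
    have := star_mul_self_nonneg a
    rwa [has] at this
  have h1 := conj_mono hp.2.1 (mul_self_le_smul_one has)
  rw [mul_smul_comm, smul_mul_assoc, mul_one, hp.2.2, ← mul_assoc, hpa, mul_assoc, hap] at h1
  exact hψ.val_ne_top_of_le (mul_mem ha ha) (real_smul_mem_vna _ hp.1) h0 h1
    (hψ.val_smul_ne_top hp.1 hp.nonneg hfin _ (by positivity))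

/-- Proposition 4.2.  Let `N ⊆ M` with faithful normal conditional
expectation `E : M → N` and `φ` a faithful normal state on `M` with `φ ∘ E = φ`, such
that `(M, N, φ)` is intertwining stable.  Let `Θ ∈ Aut(M)` with `E ∘ Θ = Θ ∘ E` and
`Θ(φ) = u φ u*` for some unitary `u ∈ N`, and let `ψ` be a strictly semifinite faithful
normal weight on `N` (with modular flow `σN`).  If `Θ` is locally pointwise inner for
`ψ ∘ E` (whose modular flow is `σM`), then `Θ_N = Θ|_N` is locally pointwise inner
for `ψ`. -/
theorem restriction_locally_pointwise_inner
    {H : Type} [NormedAddCommGroup H] [InnerProductSpace ℂ H] [CompleteSpace H]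
    (M N : VonNeumannAlgebra H) (E : Op H → Op H) (φ : Op H → ℂ)
    (hE : IsCondExp M N E) (hφ : IsFNState M φ) (hφE : ∀ x ∈ M, φ (E x) = φ x)
    (hstable : IntertwiningStable M N E φ)
    (Θ : VNAut M) (hcomm : ∀ x ∈ M, E (Θ.toFun x) = Θ.toFun (E x))
    (u : Op H) (hu : IsUnitaryIn (N : Set (Op H)) u)
    (hΘφ : ∀ x ∈ M, φ (Θ.invFun x) = φ (star u * x * u))
    (ψ : WeightData H) (σN : ℝ → Op H → Op H)
    (hψ : IsFNSWeight N ψ) (hσN : IsModularFlowW N ψ σN)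
    (hss : IsStrictlySemifiniteOn N ψ σN)
    (σM : ℝ → Op H → Op H)
    (hσM : IsModularFlowW M ⟨fun x => ψ.val (E x), fun x => ψ.cval (E x)⟩ σM)
    (hlpi : LocallyPointwiseInnerW ⟨fun x => ψ.val (E x), fun x => ψ.cval (E x)⟩ σM Θ)
    (ΘN : VNAut N)
    (hres : ∀ x ∈ N, ΘN.toFun x = Θ.toFun x)
    (hresi : ∀ x ∈ N, ΘN.invFun x = Θ.invFun x) :
    LocallyPointwiseInnerW ψ σN ΘN := by
  have hsub := hE.subset'
  refine ⟨fun x hx hx0 => ?_, ?_⟩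
  · have h1 := hlpi.1 x (hsub hx) hx0
    simp only [← hresi x hx, hE.fix' _ (ΘN.inv_mem' x hx), hE.fix' x hx] at h1
    exact h1
  intro p hp hp0 hpfin h hh k hk hkpos hkk
  obtain ⟨hhN, hhpos, hph, hhp, h', hh'N, hph', hh'p, hhh', hh'h⟩ := hh
  have hpN : IsProjIn (N : Set (Op H)) p := ⟨hp.1.1, hp.2⟩
  have hks : star k = k := IsSelfAdjoint.of_nonneg (isPos_iff.mp hkpos)
  have hhs : star h = h := IsSelfAdjoint.of_nonneg (isPos_iff.mp hhpos)
  have hh's : star h' = h' := by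
    have h1 : star h' * h = p := by
      have := congrArg star hhh'
      rwa [star_mul, hhs, hp.2.1] at this
    have h2 : star h' * p = star h' := by
      have := congrArg star hph'
      rwa [star_mul, hp.2.1] at this
    rw [← h2, ← hhh', ← mul_assoc, h1, hph']
  have hkp : k * (1 - p) = 0 := by
    apply eq_zero_of_mul_self
    rw [star_mul, hpN.one_sub.2.1, hks, mul_assoc, ← mul_assoc k, hkk, ← mul_assoc, sub_mul,
      one_mul, hph, sub_self, zero_mul]
  have hpk : p * k = k := by
    rw [mul_sub, mul_one, sub_eq_zero] at hkp
    have := congrArg star hkp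
    rw [star_mul, hks, hp.2.1] at this
    exact this.symm
  have hfix : ∀ a ∈ flowFixed N σN, star a = a → p * a = a → a ∈ flowFixed M σM :=
    fun a ha has hpa => mem_flowFixed_of_condExp hE hψ hσN hσM ha has
      (hψ.val_mul_self_ne_top hpN hpfin ha.1 has hpa)
  have hhfin : ψ.val h ≠ ⊤ := by
    rw [← hkk]
    exact hψ.val_mul_self_ne_top hpN hpfin hk.1 hks hpk
  have hint := hlpi.2 p ⟨hfix p hp.1 hp.2.1 hp.2.2, hp.2⟩ hp0
    (by simpa only [hE.fix' p hpN.1] using hpfin) h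
    ⟨hfix h hhN hhs hph, hhpos, hph, hhp, h', hfix h' hh'N hh's hph', hph', hh'p, hhh', hh'h⟩
    k (hfix k hk hks hpk) hkpos hkk
  have huM : IsUnitaryIn (M : Set (Op H)) u := ⟨hsub hu.1, hu.2⟩
  have huMx : ∀ x ∈ M, u * x * star u ∈ M := fun x hx =>
    mul_mem (mul_mem huM.1 hx) (star_mem huM.1)
  have hχ := hψ.isNormalPLF_conj hpN hpfin hk.1 hks hpk
  have hχ0 : ∃ x ∈ N, ψ.cval (k * x * k) ≠ 0 := by
    refine ⟨1, one_mem N, fun h0 => hp0 ?_⟩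
    rw [mul_one, hkk, hψ.cval_eq hhN.1 (isPos_iff.mp hhpos) hhfin, Complex.ofReal_eq_zero,
      ENNReal.toReal_eq_zero_iff] at h0
    rw [← hhh', hψ.faithful h hhN.1 hhpos (h0.resolve_right hhfin), zero_mul]
  have key := hstable (Θ.conjUnitary u huM)
    (fun x hx => by
      simp only [VNAut.conjUnitary]
      rw [hE.bimod' _ (star_mem hu.1) _ (Θ.mem' x hx) _ hu.1, hcomm x hx])
    (fun x hx => by
      simp only [VNAut.conjUnitary]
      rw [hΘφ _ (huMx x hx)]
      congr 1
      simp only [mul_assoc, hu.2.1, mul_one]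
      rw [← mul_assoc, hu.2.1, one_mul])
    _ hχ hχ0
    ((hint.conj_unitary huM).congr
      (fun x hx => congrArg ψ.cval (hE.bimod' k hk.1 _ (Θ.inv_mem' _ (huMx x hx)) k hk.1))
      (fun x hx => congrArg ψ.cval (hE.bimod' k hk.1 x hx k hk.1)))
  refine (key.conj_unitary (w := star u)
    ⟨star_mem hu.1, by rw [star_star, hu.2.2], by rw [star_star, hu.2.1]⟩).congr
    (fun x hx => ?_) (fun x _ => rfl)
  have h1 : u * (star u * x * star (star u)) * star u = x := by
    simp only [star_star, mul_assoc, hu.2.2, mul_one]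
    rw [← mul_assoc, hu.2.2, one_mul]
  simp only [VNAut.conjUnitary, h1, hresi x hx]

end HSC
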